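/- arXiv:0807.1002 — 6 statements merged into one kernel-verified Lean document; each statement's English description precedes it below -/
import Mathlib

section
/- Let M be a model category, A a cofibrant object and X a fibrant object of M. Then the homotopy relation ∼ on Hom(A,X) — where f ∼ g iff there exist an object I, morphisms i₀, i₁ : A → I and p : I → A with p a weak equivalence, p ∘ i₀ = id_A = p ∘ i₁, and a morphism H : I → X with H ∘ i₀ = f and H ∘ i₁ = g — is an equivalence relation on Hom(A,X). -/
open CategoryTheory Limits

universe v u

/-- A class of morphisms is closed under retracts. -/
def RetractClosed {M : Type u} [Category.{v} M] (P : MorphismProperty M) : Prop :=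
  ∀ {X Y X' Y' : M} (f : X ⟶ Y) (g : X' ⟶ Y')
    (iX : X ⟶ X') (rX : X' ⟶ X) (iY : Y ⟶ Y') (rY : Y' ⟶ Y),
    iX ≫ rX = 𝟙 X → iY ≫ rY = 𝟙 Y → iX ≫ g = f ≫ iY → g ≫ rY = rX ≫ f →
    P g → P f

/-- A (Quillen) model structure on a category `M`: finite limits and colimits, plus
classes `W` (weak equivalences), `Fib` (fibrations) and `Cof` (cofibrations)
satisfying Quillen's axioms. -/
structure ModelStructure (M : Type u) [Category.{v} M] where
  hasFiniteLimits : HasFiniteLimits M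
  hasFiniteColimits : HasFiniteColimits M
  W : MorphismProperty M
  Fib : MorphismProperty M
  Cof : MorphismProperty M
  id_mem : ∀ X : M, W (𝟙 X) ∧ Fib (𝟙 X) ∧ Cof (𝟙 X)
  twoOfThree₁ : ∀ {X Y Z : M} (f : X ⟶ Y) (g : Y ⟶ Z), W f → W g → W (f ≫ g)
  twoOfThree₂ : ∀ {X Y Z : M} (f : X ⟶ Y) (g : Y ⟶ Z), W f → W (f ≫ g) → W g
  twoOfThree₃ : ∀ {X Y Z : M} (f : X ⟶ Y) (g : Y ⟶ Z), W g → W (f ≫ g) → W f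
  retractW : RetractClosed W
  retractFib : RetractClosed Fib
  retractCof : RetractClosed Cof
  lifting : ∀ {A B X Y : M} (i : A ⟶ B) (p : X ⟶ Y), Cof i → Fib p → (W i ∨ W p) →
    ∀ (f : A ⟶ X) (g : B ⟶ Y), f ≫ p = i ≫ g → ∃ h : B ⟶ X, i ≫ h = f ∧ h ≫ p = g
  factTrivCofFib : ∀ {X Y : M} (f : X ⟶ Y),
    ∃ (Z : M) (i : X ⟶ Z) (p : Z ⟶ Y), Cof i ∧ W i ∧ Fib p ∧ i ≫ p = f
  factCofTrivFib : ∀ {X Y : M} (f : X ⟶ Y),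
    ∃ (Z : M) (i : X ⟶ Z) (p : Z ⟶ Y), Cof i ∧ Fib p ∧ W p ∧ i ≫ p = f

/-- An object is cofibrant if the unique map from an initial object to it is a cofibration. -/
def ModelStructure.Cofibrant {M : Type u} [Category.{v} M] (S : ModelStructure M) (A : M) : Prop :=
  ∃ (O : M) (h : IsInitial O), S.Cof (h.to A)

/-- An object is fibrant if the unique map from it to a terminal object is a fibration. -/
def ModelStructure.Fibrant {M : Type u} [Category.{v} M] (S : ModelStructure M) (X : M) : Prop :=
  ∃ (T : M) (h : IsTerminal T), S.Fib (h.from X)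

/-- The (left/right) homotopy relation of the paper: `f ∼ g` iff there are `I`,
`i₀ i₁ : A ⟶ I`, `p : I ⟶ A` with `p` a weak equivalence, `i₀ ≫ p = 𝟙 A = i₁ ≫ p`,
and `H : I ⟶ X` with `i₀ ≫ H = f` and `i₁ ≫ H = g`. -/
def ModelStructure.Homotopic {M : Type u} [Category.{v} M] (S : ModelStructure M)
    {A X : M} (f g : A ⟶ X) : Prop :=
  ∃ (I : M) (i₀ i₁ : A ⟶ I) (p : I ⟶ A) (H : I ⟶ X),
    S.W p ∧ i₀ ≫ p = 𝟙 A ∧ i₁ ≫ p = 𝟙 A ∧ i₀ ≫ H = f ∧ i₁ ≫ H = g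

theorem RetractClosed.stable {M : Type u} [Category.{v} M] {P : MorphismProperty M}
    (h : RetractClosed P) : P.IsStableUnderRetracts where
  of_retract {X Y Z W f g} r hg :=
    h f g r.i.left r.r.left r.i.right r.r.right r.retract_left r.retract_right
      r.i_w r.r_w.symm hg

/-- The Mathlib model category attached to a model structure. -/
@[reducible]
def ModelStructure.toModelCategory {M : Type u} [Category.{v} M] (S : ModelStructure M) :
    HomotopicalAlgebra.ModelCategory M :=
  letI c1 : HomotopicalAlgebra.CategoryWithFibrations M := ⟨S.Fib⟩
  letI c2 : HomotopicalAlgebra.CategoryWithCofibrations M := ⟨S.Cof⟩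
  letI c3 : HomotopicalAlgebra.CategoryWithWeakEquivalences M := ⟨S.W⟩
  { categoryWithFibrations := c1
    categoryWithCofibrations := c2
    categoryWithWeakEquivalences := c3
    cm1a := S.hasFiniteLimits
    cm1b := S.hasFiniteColimits
    cm2 :=
      { comp_mem := fun f g hf hg => S.twoOfThree₁ f g hf hg
        of_precomp := fun f g hf hfg => S.twoOfThree₂ f g hf hfg
        of_postcomp := fun f g hg hfg => S.twoOfThree₃ f g hg hfg }
    cm3a := RetractClosed.stable S.retractW
    cm3b := RetractClosed.stable S.retractFib
    cm3c := RetractClosed.stable S.retractCof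
    cm4a := fun i p hi hw hp => ⟨fun {f g} sq => by
      obtain ⟨h, h1, h2⟩ := S.lifting i p hi.mem hp.mem (Or.inl hw.mem) f g sq.w
      exact ⟨⟨⟨h, h1, h2⟩⟩⟩⟩
    cm4b := fun i p hi hp hw => ⟨fun {f g} sq => by
      obtain ⟨h, h1, h2⟩ := S.lifting i p hi.mem hp.mem (Or.inr hw.mem) f g sq.w
      exact ⟨⟨⟨h, h1, h2⟩⟩⟩⟩
    cm5a := ⟨fun f => by
      obtain ⟨Z, i, p, h1, h2, h3, h4⟩ := S.factTrivCofFib f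
      exact ⟨⟨Z, i, p, h4, ⟨h1, h2⟩, h3⟩⟩⟩
    cm5b := ⟨fun f => by
      obtain ⟨Z, i, p, h1, h2, h3, h4⟩ := S.factCofTrivFib f
      exact ⟨⟨Z, i, p, h4, h1, ⟨h2, h3⟩⟩⟩⟩ }

/-- for `A` cofibrant and `X` fibrant, the homotopy relation on
`Hom(A, X)` is an equivalence relation. -/
theorem homotopic_equivalence {M : Type u} [Category.{v} M] (S : ModelStructure M)
    {A X : M} (hA : S.Cofibrant A) (hX : S.Fibrant X) :
    _root_.Equivalence (fun f g : A ⟶ X => S.Homotopic f g) := by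
  letI := S.toModelCategory
  obtain ⟨O, hO, hc⟩ := hA
  haveI : HomotopicalAlgebra.IsCofibrant A :=
    (HomotopicalAlgebra.isCofibrant_iff_of_isInitial (hO.to A) hO).2 ⟨hc⟩
  have key : ∀ f g : A ⟶ X, HomotopicalAlgebra.LeftHomotopyRel f g ↔ S.Homotopic f g := by
    intro f g
    constructor
    · rintro ⟨P, ⟨h⟩⟩
      exact ⟨P.I, P.i₀, P.i₁, P.π, h.h, P.weakEquivalence_π.mem, P.i₀_π, P.i₁_π, h.h₀, h.h₁⟩
    · rintro ⟨I, i₀, i₁, p, H, hp, h0, h1, hf, hg⟩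
      exact ⟨{ I := I, i₀ := i₀, i₁ := i₁, π := p, i₀_π := h0, i₁_π := h1,
               weakEquivalence_π := ⟨hp⟩ }, ⟨⟨H, hf, hg⟩⟩⟩
  have e := HomotopicalAlgebra.LeftHomotopyRel.equivalence A X
  exact ⟨fun f => (key _ _).1 (e.refl f), fun h => (key _ _).1 (e.symm ((key _ _).2 h)),
    fun h h' => (key _ _).1 (e.trans ((key _ _).2 h) ((key _ _).2 h'))⟩
end

section
/- Let U be an ultrafilter on a set ι, let (M i, W i, Fib i, Cof i) be a family of model categories, and equip M := ∏_U M i with the germwise model structure (a germ [f] lies in W, Fib, resp. Cof iff its components lie in W i, Fib i, resp. Cof i for U-almost all i). Let G : M → ∏_U Ho(M i) be the functor that is the identity on objects and sends a germ [f i] to the germ of the images of the f i under the localization functors γ i : M i → Ho(M i) := M i[W i⁻¹]. Then G sends weak equivalences of M to isomorphisms, hence factors uniquely through the localization γ : M → Ho(M) := M[W⁻¹] as G = F ∘ γ, and the induced functor F : Ho(M) → ∏_U Ho(M i) is fully faithful and bijective on objects; in particular Ho(∏_U M i) and ∏_U Ho(M i) are canonically isomorphic. -/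
open CategoryTheory Limits

universe w v u

/-- The setoid of `U`-almost-everywhere equality on the dependent product `∀ i, S i`. -/
def germSetoid {ι : Type u} (U : Ultrafilter ι) (S : ι → Type v) :
    Setoid (∀ i, S i) where
  r s t := {i | s i = t i} ∈ U
  iseqv := by
    constructor
    · intro s
      exact Filter.univ_mem' (fun i => rfl)
    · intro s t h
      exact Filter.mem_of_superset h (fun i hi => hi.symm)
    · intro s t u h₁ h₂
      exact Filter.mem_of_superset (Filter.inter_mem h₁ h₂) (fun i hi => hi.1.trans hi.2)

/-- The ultraproduct `∏_U S i` of a family of sets: the quotient of `∀ i, S i` by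
`U`-almost-everywhere equality. -/
def Ultraproduct {ι : Type u} (U : Ultrafilter ι) (S : ι → Type v) : Type (max u v) :=
  Quotient (germSetoid U S)

/-- The germ `[s]` of a family `s`. -/
def Ultraproduct.mk {ι : Type u} (U : Ultrafilter ι) {S : ι → Type v} (s : ∀ i, S i) :
    Ultraproduct U S :=
  Quotient.mk (germSetoid U S) s

/-- The ultraproduct category `∏_U C i`: objects are families of objects,
hom-sets are ultraproducts of hom-sets, with germwise composition and
germs of identities as identities. -/
def UltraCat {ι : Type u} (U : Ultrafilter ι) (C : ι → Type v)
    [∀ i, Category.{w} (C i)] : Type (max u v) :=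
  ∀ i, C i

set_option linter.unusedVariables false in
instance UltraCat.instCategory {ι : Type u} (U : Ultrafilter ι) (C : ι → Type v)
    [∀ i, Category.{w} (C i)] : Category.{max u w} (UltraCat U C) where
  Hom X Y := Ultraproduct U (fun i => X i ⟶ Y i)
  id X := Ultraproduct.mk U (fun i => 𝟙 (X i))
  comp {X Y Z} f g :=
    Quotient.liftOn₂ f g
      (fun f g => Ultraproduct.mk U (fun i => f i ≫ g i))
      (by
        intro a₁ a₂ b₁ b₂ h₁ h₂
        exact Quotient.sound (Filter.mem_of_superset (Filter.inter_mem h₁ h₂)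
          (fun i hi => by
            have e₁ : a₁ i = b₁ i := hi.1
            have e₂ : a₂ i = b₂ i := hi.2
            show a₁ i ≫ a₂ i = b₁ i ≫ b₂ i
            rw [e₁, e₂])))
  id_comp := by
    intro X Y f
    induction f using Quotient.inductionOn with
    | _ a => exact congrArg (Quotient.mk _) (funext fun i => Category.id_comp (a i))
  comp_id := by
    intro X Y f
    induction f using Quotient.inductionOn with
    | _ a => exact congrArg (Quotient.mk _) (funext fun i => Category.comp_id (a i))
  assoc := by
    intro W X Y Z f g h
    induction f using Quotient.inductionOn with
    | _ a =>
      induction g using Quotient.inductionOn with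
      | _ b =>
        induction h using Quotient.inductionOn with
        | _ c => exact congrArg (Quotient.mk _) (funext fun i => Category.assoc (a i) (b i) (c i))

/-- The morphism of the ultraproduct category determined by a family of morphisms. -/
def UltraCat.mkHom {ι : Type u} (U : Ultrafilter ι) {C : ι → Type v}
    [∀ i, Category.{w} (C i)] {X Y : UltraCat U C} (f : ∀ i, X i ⟶ Y i) : X ⟶ Y :=
  Ultraproduct.mk U f

/-- The germwise extension of a family of morphism properties to the ultraproduct
category: a germ `[f]` has the property iff its components have it `U`-almost
everywhere (this is independent of the chosen representative family). -/
def germProp {ι : Type u} (U : Ultrafilter ι) {C : ι → Type v} [∀ i, Category.{w} (C i)]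
    (P : ∀ i, MorphismProperty (C i)) : MorphismProperty (UltraCat U C) :=
  fun _X _Y f => ∀ g, f = UltraCat.mkHom U g → {i | P i (g i)} ∈ U

/-- The canonical functor `G : ∏_U M i ⥤ ∏_U Ho(M i)` which is the identity on objects
and applies the localization functors `γ i = (S i).W.Q` germwise to morphisms. -/
noncomputable def ultraLocFunctor {ι : Type u} (U : Ultrafilter ι) (M : ι → Type v)
    [∀ i, Category.{w} (M i)] (S : ∀ i, ModelStructure (M i)) :
    UltraCat U M ⥤ UltraCat U (fun i => (S i).W.Localization) where
  obj X := fun i => (S i).W.Q.obj (X i)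
  map {X Y} f :=
    Quotient.liftOn f (fun g => UltraCat.mkHom U (fun i => (S i).W.Q.map (g i)))
      (by
        intro a b h
        exact Quotient.sound (Filter.mem_of_superset h (fun i hi => by
          show (S i).W.Q.map (a i) = (S i).W.Q.map (b i)
          rw [show a i = b i from hi])))
  map_id := by
    intro X
    exact congrArg (Quotient.mk _) (funext fun i => (S i).W.Q.map_id (X i))
  map_comp := by
    intro X Y Z f g
    induction f using Quotient.inductionOn with
    | _ a =>
      induction g using Quotient.inductionOn with
      | _ b => exact congrArg (Quotient.mk _) (funext fun i => (S i).W.Q.map_comp (a i) (b i))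

namespace UltraAux

open HomotopicalAlgebra

/-- The Mathlib model category attached to a model structure. -/
@[reducible] def toMC {M : Type u} [Category.{v} M] (S : ModelStructure M) : ModelCategory M :=
  letI i1 : CategoryWithFibrations M := ⟨S.Fib⟩
  letI i2 : CategoryWithCofibrations M := ⟨S.Cof⟩
  letI i3 : CategoryWithWeakEquivalences M := ⟨S.W⟩
  { categoryWithFibrations := i1
    categoryWithCofibrations := i2
    categoryWithWeakEquivalences := i3
    cm1a := S.hasFiniteLimits
    cm1b := S.hasFiniteColimits
    cm2 :=
      { comp_mem := fun f g hf hg => S.twoOfThree₁ f g hf hg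
        of_postcomp := fun f g hg hfg => S.twoOfThree₃ f g hg hfg
        of_precomp := fun f g hf hfg => S.twoOfThree₂ f g hf hfg }
    cm3a := ⟨fun {_ _ _ _ f g} r hg => S.retractW f g r.i.left r.r.left r.i.right r.r.right
      r.retract_left r.retract_right r.i_w r.r_w.symm hg⟩
    cm3b := ⟨fun {_ _ _ _ f g} r hg => S.retractFib f g r.i.left r.r.left r.i.right r.r.right
      r.retract_left r.retract_right r.i_w r.r_w.symm hg⟩
    cm3c := ⟨fun {_ _ _ _ f g} r hg => S.retractCof f g r.i.left r.r.left r.i.right r.r.right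
      r.retract_left r.retract_right r.i_w r.r_w.symm hg⟩
    cm4a := fun i p hi hwi hp => ⟨fun {f g} sq => by
      obtain ⟨h, h1, h2⟩ := S.lifting i p hi.mem hp.mem (Or.inl hwi.mem) f g sq.w
      exact ⟨⟨⟨h, h1, h2⟩⟩⟩⟩
    cm4b := fun i p hi hp hwp => ⟨fun {f g} sq => by
      obtain ⟨h, h1, h2⟩ := S.lifting i p hi.mem hp.mem (Or.inr hwp.mem) f g sq.w
      exact ⟨⟨⟨h, h1, h2⟩⟩⟩⟩
    cm5a := ⟨fun f => by
      obtain ⟨Z, i, p, h1, h2, h3, h4⟩ := S.factTrivCofFib f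
      exact ⟨{ Z := Z, i := i, p := p, fac := h4, hi := ⟨h1, h2⟩, hp := h3 }⟩⟩
    cm5b := ⟨fun f => by
      obtain ⟨Z, i, p, h1, h2, h3, h4⟩ := S.factCofTrivFib f
      exact ⟨{ Z := Z, i := i, p := p, fac := h4, hi := h1, hp := ⟨h2, h3⟩ }⟩⟩ }

section

variable {M : Type u} [Category.{v} M] (S : ModelStructure M)

lemma exists_cof (X : M) : ∃ (X' O : M) (_ : IsInitial O) (i : O ⟶ X') (p : X' ⟶ X),
    S.Cof i ∧ S.W p := by
  have := S.hasFiniteColimits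
  obtain ⟨Z, i, p, h1, _, h3, _⟩ := S.factCofTrivFib (initial.to X)
  exact ⟨Z, _, initialIsInitial, i, p, h1, h3⟩

lemma exists_fib (X : M) : ∃ (X' O : M) (_ : IsTerminal O) (i : X' ⟶ O) (p : X ⟶ X'),
    S.Fib i ∧ S.W p := by
  have := S.hasFiniteLimits
  obtain ⟨Z, i, p, _, h1, h3, _⟩ := S.factTrivCofFib (terminal.from X)
  exact ⟨Z, _, terminalIsTerminal, p, i, h3, h1⟩

lemma surj {O X Y P : M} (hO : IsInitial O) (i : O ⟶ X) (hi : S.Cof i)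
    (hP : IsTerminal P) (p : Y ⟶ P) (hp : S.Fib p) (φ : S.W.Q.obj X ⟶ S.W.Q.obj Y) :
    ∃ f : X ⟶ Y, S.W.Q.map f = φ := by
  letI := toMC S
  haveI : IsCofibrant X := (isCofibrant_iff_of_isInitial i hO).2 ⟨hi⟩
  haveI : IsFibrant Y := (isFibrant_iff_of_isTerminal p hP).2 ⟨hp⟩
  haveI : S.W.Q.IsLocalization (weakEquivalences M) :=
    inferInstanceAs (S.W.Q.IsLocalization S.W)
  exact map_surjective_of_isLocalization S.W.Q X Y φ

lemma inj {O X Y P : M} (hO : IsInitial O) (i : O ⟶ X) (hi : S.Cof i)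
    (hP : IsTerminal P) (p : Y ⟶ P) (hp : S.Fib p) (f g : X ⟶ Y)
    (h : S.W.Q.map f = S.W.Q.map g) : S.Homotopic f g := by
  letI := toMC S
  haveI : IsCofibrant X := (isCofibrant_iff_of_isInitial i hO).2 ⟨hi⟩
  haveI : IsFibrant Y := (isFibrant_iff_of_isTerminal p hP).2 ⟨hp⟩
  haveI : S.W.Q.IsLocalization (weakEquivalences M) :=
    inferInstanceAs (S.W.Q.IsLocalization S.W)
  obtain ⟨P, ⟨H⟩⟩ := (LeftHomotopyRel.iff_map_eq S.W.Q X Y).2 h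
  exact ⟨P.I, P.i₀, P.i₁, P.π, H.h, P.weakEquivalence_π.mem, P.i₀_π, P.i₁_π, H.h₀, H.h₁⟩

lemma map_eq_of_homotopic {X Y : M} (f g : X ⟶ Y) (h : S.Homotopic f g) :
    S.W.Q.map f = S.W.Q.map g := by
  obtain ⟨I, i₀, i₁, p, H, hp, h0, h1, rfl, rfl⟩ := h
  haveI : IsIso (S.W.Q.map p) := Localization.inverts S.W.Q S.W p hp
  have : S.W.Q.map i₀ = S.W.Q.map i₁ := by
    rw [← cancel_mono (S.W.Q.map p), ← Functor.map_comp, ← Functor.map_comp, h0, h1]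
  rw [Functor.map_comp, Functor.map_comp, this]

end

section

variable {ι : Type u} (U : Ultrafilter ι)

lemma exists_family {S : ι → Type w} (P : ∀ i, S i → Prop)
    (hne : ∀ i, ({i} : Set ι)ᶜ ∈ U → Nonempty (S i)) (h : {i | ∃ x, P i x} ∈ U) :
    ∃ s : ∀ i, S i, {i | P i (s i)} ∈ U := by
  have : ∀ i, ∃ x : S i, (∃ x, P i x) → P i x := by
    intro i
    by_cases hi : ∃ x, P i x
    · obtain ⟨x, hx⟩ := hi
      exact ⟨x, fun _ => hx⟩
    · obtain ⟨x⟩ := hne i (Filter.mem_of_superset h (by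
        rintro j hj rfl
        exact hi hj))
      exact ⟨x, fun h => absurd h hi⟩
  choose s hs using this
  exact ⟨s, Filter.mem_of_superset h (fun i hi => hs i hi)⟩

variable {C : ι → Type v} [∀ i, Category.{w} (C i)]

lemma mkHom_surj {X Y : UltraCat U C} (f : X ⟶ Y) :
    ∃ g : ∀ i, X i ⟶ Y i, f = UltraCat.mkHom U g := by
  obtain ⟨g, hg⟩ := Quotient.exists_rep f
  exact ⟨g, hg.symm⟩

lemma mkHom_eq_iff {X Y : UltraCat U C} (f g : ∀ i, X i ⟶ Y i) :
    (UltraCat.mkHom U f : X ⟶ Y) = UltraCat.mkHom U g ↔ {i | f i = g i} ∈ U :=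
  ⟨fun h => Quotient.exact h, fun h => Quotient.sound h⟩

lemma mkHom_comp {X Y Z : UltraCat U C} (f : ∀ i, X i ⟶ Y i) (g : ∀ i, Y i ⟶ Z i) :
    (UltraCat.mkHom U f : X ⟶ Y) ≫ (UltraCat.mkHom U g : Y ⟶ Z) =
      UltraCat.mkHom U (fun i => f i ≫ g i) := rfl

lemma id_eq (X : UltraCat U C) : 𝟙 X = UltraCat.mkHom U (fun i => 𝟙 (X i)) := rfl

lemma germProp_mk (P : ∀ i, MorphismProperty (C i)) {X Y : UltraCat U C}
    (f : ∀ i, X i ⟶ Y i) :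
    germProp U P (UltraCat.mkHom U f : X ⟶ Y) ↔ {i | P i (f i)} ∈ U := by
  refine ⟨fun h => h f rfl, fun h g hg => ?_⟩
  rw [mkHom_eq_iff] at hg
  filter_upwards [h, hg] with i h1 h2
  have h2 : f i = g i := h2
  have h1 : P i (f i) := h1
  exact h2 ▸ h1

lemma germProp_mk' (P : ∀ i, MorphismProperty (C i)) {X Y : UltraCat U C}
    (f : ∀ i, X i ⟶ Y i) (h : ∀ i, P i (f i)) :
    germProp U P (UltraCat.mkHom U f : X ⟶ Y) :=
  (germProp_mk U P f).2 (Filter.univ_mem' h)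

/-- A family of initial objects is initial. -/
def initialFam (O : UltraCat U C) (hO : ∀ i, IsInitial (O i)) : IsInitial O :=
  IsInitial.ofUniqueHom (fun Y => UltraCat.mkHom U (fun i => (hO i).to (Y i))) (by
    intro Y m
    obtain ⟨g, rfl⟩ := mkHom_surj U m
    rw [mkHom_eq_iff]
    exact Filter.univ_mem' (fun i => (hO i).hom_ext _ _))

/-- A family of terminal objects is terminal. -/
def terminalFam (O : UltraCat U C) (hO : ∀ i, IsTerminal (O i)) : IsTerminal O :=
  IsTerminal.ofUniqueHom (fun Y => UltraCat.mkHom U (fun i => (hO i).from (Y i))) (by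
    intro Y m
    obtain ⟨g, rfl⟩ := mkHom_surj U m
    rw [mkHom_eq_iff]
    exact Filter.univ_mem' (fun i => (hO i).hom_ext _ _))

end

lemma to_mem {M : Type u} [Category.{v} M] (P : MorphismProperty M) (hP : ∀ X, P (𝟙 X))
    {O : M} (hO : IsInitial O) (Z : M) (h : Z = O) : P (hO.to Z) := by
  subst h
  rw [hO.hom_ext (hO.to Z) (𝟙 Z)]
  exact hP _

section

variable {ι : Type u} (U : Ultrafilter ι)
    (M : ι → Type v) [∀ i, Category.{w} (M i)] (S : ∀ i, ModelStructure (M i))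
    (T : ModelStructure (UltraCat U M))
    (hW : T.W = germProp U (fun i => (S i).W))
    (hFib : T.Fib = germProp U (fun i => (S i).Fib))
    (hCof : T.Cof = germProp U (fun i => (S i).Cof))

include hW hFib hCof in
/-- The lifting axiom in the ultraproduct forces hom-sets at negligible indices to be
nonempty. -/
lemma nonempty_hom (i : ι) (hi : ({i} : Set ι)ᶜ ∈ U) (X Y : M i) : Nonempty (X ⟶ Y) := by
  classical
  have hh : ∀ j, ∃ O : M j, Nonempty (IsInitial O) := fun j => by
    have := (S j).hasFiniteColimits
    exact ⟨_, ⟨initialIsInitial⟩⟩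
  choose O hO using hh
  have hO := fun j => (hO j).some
  let B : ∀ j, M j := Function.update O i X
  have hB : ∀ j, j ≠ i → B j = O j := fun j hj => Function.update_of_ne hj _ _
  let e : @Quiver.Hom (UltraCat U M) _ O B := UltraCat.mkHom U (fun j => (hO j).to (B j))
  have key : ∀ P : ∀ j, MorphismProperty (M j), (∀ j Z, P j (𝟙 Z)) → germProp U P e := by
    intro P hP
    refine (germProp_mk U P _).2 (Filter.mem_of_superset hi ?_)
    intro j hj
    exact to_mem (P j) (hP j) (hO j) _ (hB j hj)
  obtain ⟨h, -, -⟩ := T.lifting e e (hCof ▸ key _ (fun j Z => ((S j).id_mem Z).2.2))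
    (hFib ▸ key _ (fun j Z => ((S j).id_mem Z).2.1))
    (Or.inl (hW ▸ key _ (fun j Z => ((S j).id_mem Z).1))) (𝟙 _) (𝟙 _)
    ((Category.id_comp e).trans (Category.comp_id e).symm)
  obtain ⟨g, -⟩ := mkHom_surj U h
  have g' : X ⟶ O i := eqToHom (Function.update_self i X O).symm ≫ g i
  exact ⟨g' ≫ (hO i).to Y⟩

lemma G_map {X Y : UltraCat U M} (f : ∀ i, X i ⟶ Y i) :
    (ultraLocFunctor U M S).map (UltraCat.mkHom U f : X ⟶ Y) =
      UltraCat.mkHom U (fun i => (S i).W.Q.map (f i)) := rfl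

include hW hFib hCof in
lemma inverted : T.W.IsInvertedBy (ultraLocFunctor U M S) := by
  intro X Y f hf
  obtain ⟨f, rfl⟩ := mkHom_surj U f
  rw [hW, germProp_mk] at hf
  obtain ⟨s, hs⟩ := exists_family U
    (S := fun i => (S i).W.Q.obj (Y i) ⟶ (S i).W.Q.obj (X i))
    (fun i s => (S i).W.Q.map (f i) ≫ s = 𝟙 _ ∧ s ≫ (S i).W.Q.map (f i) = 𝟙 _)
    (fun i hi => (nonempty_hom U M S T hW hFib hCof i hi (Y i) (X i)).map
      (fun g => (S i).W.Q.map g))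
    (Filter.mem_of_superset hf (fun i hi => by
      haveI : IsIso ((S i).W.Q.map (f i)) := Localization.inverts (S i).W.Q (S i).W _ hi
      exact ⟨inv ((S i).W.Q.map (f i)), by simp, by simp⟩))
  refine ⟨UltraCat.mkHom U s, ?_, ?_⟩
  · exact Quotient.sound (Filter.mem_of_superset hs (fun i hi => hi.1))
  · exact Quotient.sound (Filter.mem_of_superset hs (fun i hi => hi.2))

include hW in
lemma homotopic_germ {X Y : UltraCat U M} (f g : ∀ i, X i ⟶ Y i)
    (h : {i | (S i).Homotopic (f i) (g i)} ∈ U) :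
    T.Homotopic (UltraCat.mkHom U f : X ⟶ Y) (UltraCat.mkHom U g) := by
  have : ∀ i, ∃ (I : M i) (i₀ i₁ : X i ⟶ I) (p : I ⟶ X i) (H : I ⟶ Y i),
      (S i).Homotopic (f i) (g i) → (S i).W p ∧ i₀ ≫ p = 𝟙 _ ∧ i₁ ≫ p = 𝟙 _ ∧
        i₀ ≫ H = f i ∧ i₁ ≫ H = g i := by
    intro i
    by_cases hi : (S i).Homotopic (f i) (g i)
    · obtain ⟨I, a, b, c, d, h⟩ := hi
      exact ⟨I, a, b, c, d, fun _ => h⟩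
    · exact ⟨X i, 𝟙 _, 𝟙 _, 𝟙 _, f i, fun h => absurd h hi⟩
  choose I i₀ i₁ p H hh using this
  refine ⟨(I : UltraCat U M), UltraCat.mkHom U i₀, UltraCat.mkHom U i₁, UltraCat.mkHom U p,
    UltraCat.mkHom U H, ?_, ?_, ?_, ?_, ?_⟩
  · rw [hW]
    exact (germProp_mk U _ _).2 (Filter.mem_of_superset h (fun i hi => (hh i hi).1))
  · exact Quotient.sound (Filter.mem_of_superset h (fun i hi => (hh i hi).2.1))
  · exact Quotient.sound (Filter.mem_of_superset h (fun i hi => (hh i hi).2.2.1))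
  · exact Quotient.sound (Filter.mem_of_superset h (fun i hi => (hh i hi).2.2.2.1))
  · exact Quotient.sound (Filter.mem_of_superset h (fun i hi => (hh i hi).2.2.2.2))

include hW hFib hCof in
lemma main_props (X Y : UltraCat U M) : ∃ (X' Y' : UltraCat U M) (p : X' ⟶ X) (j : Y ⟶ Y'),
    T.W p ∧ T.W j ∧ (∀ ψ : T.W.Q.obj X' ⟶ T.W.Q.obj Y', ∃ f, T.W.Q.map f = ψ) ∧
    (∀ f g : X' ⟶ Y', (ultraLocFunctor U M S).map f = (ultraLocFunctor U M S).map g →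
      T.W.Q.map f = T.W.Q.map g) ∧
    (∀ φ : (ultraLocFunctor U M S).obj X' ⟶ (ultraLocFunctor U M S).obj Y',
      ∃ f, (ultraLocFunctor U M S).map f = φ) := by
  choose X' O hO k p hk hp using fun i => exists_cof (S i) (X i)
  choose Y' E hE q j hq hj using fun i => exists_fib (S i) (Y i)
  refine ⟨(X' : UltraCat U M), (Y' : UltraCat U M), UltraCat.mkHom U p, UltraCat.mkHom U j,
    hW ▸ germProp_mk' U _ _ hp, hW ▸ germProp_mk' U _ _ hj, ?_, ?_, ?_⟩
  · exact surj T (initialFam U (O : UltraCat U M) hO)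
      (@UltraCat.mkHom _ U M _ O X' k)
      (hCof ▸ germProp_mk' U _ _ hk) (terminalFam U (E : UltraCat U M) hE)
      (@UltraCat.mkHom _ U M _ Y' E q)
      (hFib ▸ germProp_mk' U _ _ hq)
  · intro f g hfg
    obtain ⟨f, rfl⟩ := mkHom_surj U f
    obtain ⟨g, rfl⟩ := mkHom_surj U g
    have hfg := (mkHom_eq_iff U _ _).1 hfg
    exact map_eq_of_homotopic T _ _ (homotopic_germ U M S T hW f g
      (Filter.mem_of_superset hfg (fun i hi =>
        inj (S i) (hO i) (k i) (hk i) (hE i) (q i) (hq i) _ _ hi)))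
  · intro φ
    obtain ⟨φ, rfl⟩ := mkHom_surj U φ
    choose f hf using fun i => surj (S i) (hO i) (k i) (hk i) (hE i) (q i) (hq i) (φ i)
    exact ⟨UltraCat.mkHom U f, Quotient.sound (Filter.univ_mem' hf)⟩

end

lemma Q_obj_bijective {M : Type u} [Category.{v} M] (W : MorphismProperty M) :
    Function.Bijective W.Q.obj :=
  (Localization.Construction.objEquiv W).bijective

lemma ff {C : Type*} [Category* C] {D : Type*} [Category* D] (W : MorphismProperty C)
    (F : W.Localization ⥤ D) (K : C ⥤ D) (hK : W.Q ⋙ F = K)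
    (H : ∀ X Y : C, ∃ (X' Y' : C) (p : X' ⟶ X) (j : Y ⟶ Y'),
      W p ∧ W j ∧ (∀ ψ : W.Q.obj X' ⟶ W.Q.obj Y', ∃ f, W.Q.map f = ψ) ∧
      (∀ f g : X' ⟶ Y', K.map f = K.map g → W.Q.map f = W.Q.map g) ∧
      (∀ φ : K.obj X' ⟶ K.obj Y', ∃ f, K.map f = φ)) : F.Full ∧ F.Faithful := by
  subst hK
  constructor
  · refine ⟨fun {A B} φ => ?_⟩
    obtain ⟨X, rfl⟩ := (Q_obj_bijective W).2 A
    obtain ⟨Y, rfl⟩ := (Q_obj_bijective W).2 B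
    obtain ⟨X', Y', p, j, hp, hj, -, -, h3⟩ := H X Y
    haveI : IsIso (W.Q.map p) := Localization.inverts W.Q W p hp
    haveI : IsIso (W.Q.map j) := Localization.inverts W.Q W j hj
    obtain ⟨f, hf⟩ := h3 (F.map (W.Q.map p) ≫ φ ≫ F.map (W.Q.map j))
    refine ⟨inv (W.Q.map p) ≫ W.Q.map f ≫ inv (W.Q.map j), ?_⟩
    have hf : F.map (W.Q.map f) = F.map (W.Q.map p) ≫ φ ≫ F.map (W.Q.map j) := hf
    rw [F.map_comp, F.map_comp, hf]
    simp
  · refine ⟨fun {A B} a b hab => ?_⟩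
    obtain ⟨X, rfl⟩ := (Q_obj_bijective W).2 A
    obtain ⟨Y, rfl⟩ := (Q_obj_bijective W).2 B
    obtain ⟨X', Y', p, j, hp, hj, h1, h2, -⟩ := H X Y
    haveI : IsIso (W.Q.map p) := Localization.inverts W.Q W p hp
    haveI : IsIso (W.Q.map j) := Localization.inverts W.Q W j hj
    obtain ⟨f, hf⟩ := h1 (W.Q.map p ≫ a ≫ W.Q.map j)
    obtain ⟨g, hg⟩ := h1 (W.Q.map p ≫ b ≫ W.Q.map j)
    have : W.Q.map f = W.Q.map g := h2 f g (by
      rw [Functor.comp_map, Functor.comp_map, hf, hg]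
      simp [hab])
    rw [hf, hg] at this
    exact (cancel_mono (W.Q.map j)).1 ((cancel_epi (W.Q.map p)).1 this)

end UltraAux

/-- if `M = ∏_U M i` carries the germwise model structure, then the
canonical functor `G : M ⥤ ∏_U Ho(M i)` inverts the weak equivalences, hence factors
uniquely through the localization `γ = T.W.Q : M ⥤ Ho(M)` as `G = γ ⋙ F`, and the
induced functor `F : Ho(M) ⥤ ∏_U Ho(M i)` is fully faithful and bijective on objects;
in particular `Ho(∏_U M i)` and `∏_U Ho(M i)` are canonically isomorphic. -/
theorem ultraCat_homotopyCategory {ι : Type u} (U : Ultrafilter ι)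
    (M : ι → Type v) [∀ i, Category.{w} (M i)] (S : ∀ i, ModelStructure (M i))
    (T : ModelStructure (UltraCat U M))
    (hW : T.W = germProp U (fun i => (S i).W))
    (hFib : T.Fib = germProp U (fun i => (S i).Fib))
    (hCof : T.Cof = germProp U (fun i => (S i).Cof)) :
    T.W.IsInvertedBy (ultraLocFunctor U M S) ∧
    ∃ F : T.W.Localization ⥤ UltraCat U (fun i => (S i).W.Localization),
      T.W.Q ⋙ F = ultraLocFunctor U M S ∧
      (∀ F' : T.W.Localization ⥤ UltraCat U (fun i => (S i).W.Localization),
        T.W.Q ⋙ F' = ultraLocFunctor U M S → F' = F) ∧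
      F.Full ∧ F.Faithful ∧ Function.Bijective F.obj := by
  have hinv := UltraAux.inverted U M S T hW hFib hCof
  refine ⟨hinv, Localization.Construction.lift _ hinv, Localization.Construction.fac _ hinv,
    fun F' hF' => Localization.Construction.uniq _ _
      (hF'.trans (Localization.Construction.fac _ hinv).symm), ?_⟩
  have h1 := UltraAux.ff T.W _ _ (Localization.Construction.fac _ hinv)
    (UltraAux.main_props U M S T hW hFib hCof)
  refine ⟨h1.1, h1.2, ?_⟩
  rw [← Function.Bijective.of_comp_iff _ (UltraAux.Q_obj_bijective T.W)]
  have h2 : (Localization.Construction.lift _ hinv).obj ∘ T.W.Q.obj =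
      (ultraLocFunctor U M S).obj :=
    congrArg (fun K : UltraCat U M ⥤ _ => K.obj) (Localization.Construction.fac _ hinv)
  rw [h2]
  constructor
  · intro X Y h
    funext i
    exact (UltraAux.Q_obj_bijective (S i).W).1 (congrFun h i)
  · intro Z
    choose X hX using fun i => (UltraAux.Q_obj_bijective (S i).W).2 (Z i)
    exact ⟨X, funext hX⟩
end

section
/- Let U be an ultrafilter on a set ι, let (M i, W i, Fib i, Cof i) be a family of model categories, and equip M := ∏_U M i with the germwise model structure. Then: (a) an object A = (A i) of M is cofibrant if and only if {i | A i is cofibrant in M i} ∈ U, and an object X = (X i) is fibrant if and only if {i | X i is fibrant in M i} ∈ U; (b) if A is cofibrant and X is fibrant, then two morphisms [f i], [g i] : A → X are homotopic in M if and only if {i | f i and g i are homotopic in M i} ∈ U. In particular the set of homotopy classes Hom_M(A,X)/∼ is in canonical bijection with the ultraproduct ∏_U π(A i, X i). -/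
open CategoryTheory Limits

universe w v u

theorem UltraCat.mkHom_surj {ι : Type u} (U : Ultrafilter ι) {C : ι → Type v}
    [∀ i, Category.{w} (C i)] {X Y : UltraCat U C} (f : X ⟶ Y) :
    ∃ g : ∀ i, X i ⟶ Y i, UltraCat.mkHom U g = f :=
  Quotient.exists_rep f

theorem UltraCat.mkHom_eq_iff {ι : Type u} (U : Ultrafilter ι) {C : ι → Type v}
    [∀ i, Category.{w} (C i)] {X Y : UltraCat U C} (f g : ∀ i, X i ⟶ Y i) :
    (UltraCat.mkHom U f : X ⟶ Y) = UltraCat.mkHom U g ↔ {i | f i = g i} ∈ U :=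
  ⟨fun h => Quotient.exact h, fun h => Quotient.sound h⟩

theorem UltraCat.mkHom_comp {ι : Type u} (U : Ultrafilter ι) {C : ι → Type v}
    [∀ i, Category.{w} (C i)] {X Y Z : UltraCat U C} (f : ∀ i, X i ⟶ Y i) (g : ∀ i, Y i ⟶ Z i) :
    (UltraCat.mkHom U f : X ⟶ Y) ≫ (UltraCat.mkHom U g : Y ⟶ Z) =
      UltraCat.mkHom U (fun i => f i ≫ g i) := rfl

theorem UltraCat.id_eq {ι : Type u} (U : Ultrafilter ι) {C : ι → Type v}
    [∀ i, Category.{w} (C i)] (X : UltraCat U C) :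
    𝟙 X = UltraCat.mkHom U (fun i => 𝟙 (X i)) := rfl

theorem germProp_mkHom {ι : Type u} (U : Ultrafilter ι) {C : ι → Type v}
    [∀ i, Category.{w} (C i)] (P : ∀ i, MorphismProperty (C i))
    {X Y : UltraCat U C} (f : ∀ i, X i ⟶ Y i) :
    germProp U P (UltraCat.mkHom U f : X ⟶ Y) ↔ {i | P i (f i)} ∈ U := by
  constructor
  · intro h
    exact h f rfl
  · intro h g hg
    rw [UltraCat.mkHom_eq_iff] at hg
    filter_upwards [h, hg] with i h1 h2
    have h2 : f i = g i := h2
    show P i (g i)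
    rw [← h2]
    exact h1

theorem ModelStructure.cofibrant_iff {M : Type u} [Category.{v} M] (S : ModelStructure M) {A O : M}
    (h : IsInitial O) (f : O ⟶ A) : S.Cofibrant A ↔ S.Cof f := by
  constructor
  · rintro ⟨O', h', hc⟩
    exact S.retractCof f (h'.to A) (h.to O') (h'.to O) (𝟙 A) (𝟙 A) (h.hom_ext _ _) (by simp)
      (h.hom_ext _ _) (h'.hom_ext _ _) hc
  · intro hc
    refine ⟨O, h, ?_⟩
    rwa [h.hom_ext (h.to A) f]

theorem ModelStructure.fibrant_iff {M : Type u} [Category.{v} M] (S : ModelStructure M) {X T : M}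
    (h : IsTerminal T) (f : X ⟶ T) : S.Fibrant X ↔ S.Fib f := by
  constructor
  · rintro ⟨T', h', hc⟩
    exact S.retractFib f (h'.from X) (𝟙 X) (𝟙 X) (h'.from T) (h.from T') (by simp) (h.hom_ext _ _)
      (h'.hom_ext _ _) (h.hom_ext _ _) hc
  · intro hc
    refine ⟨T, h, ?_⟩
    rwa [h.hom_ext (h.from X) f]

theorem ModelStructure.homotopic_refl {M : Type u} [Category.{v} M] (S : ModelStructure M)
    {A X : M} (f : A ⟶ X) : S.Homotopic f f :=
  ⟨A, 𝟙 A, 𝟙 A, 𝟙 A, f, (S.id_mem A).1, by simp, by simp, by simp, by simp⟩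

theorem ModelStructure.homotopic_symm {M : Type u} [Category.{v} M] (S : ModelStructure M)
    {A X : M} {f g : A ⟶ X} : S.Homotopic f g → S.Homotopic g f := by
  rintro ⟨I, i₀, i₁, p, H, h1, h2, h3, h4, h5⟩
  exact ⟨I, i₁, i₀, p, H, h1, h3, h2, h5, h4⟩

theorem ModelStructure.pushout_W {M : Type u} [Category.{v} M] (S : ModelStructure M)
    {A B C P : M} {f : A ⟶ B} {g : A ⟶ C} {inl : B ⟶ P} {inr : C ⟶ P}
    (sq : IsPushout f g inl inr) (hc : S.Cof f) (hw : S.W f) : S.W inr := by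
  obtain ⟨Z, j, q, hjc, hjw, hq, e⟩ := S.factTrivCofFib inr
  obtain ⟨l, hl1, hl2⟩ := S.lifting f q hc hq (Or.inl hw) (g ≫ j) inl
    (by rw [Category.assoc, e, sq.w])
  have hs : sq.desc l j hl1 ≫ q = 𝟙 P := by
    apply sq.hom_ext <;> simp [hl2, e]
  exact S.retractW inr j (𝟙 C) (𝟙 C) (sq.desc l j hl1) q (by simp) hs (by simp) (by simp [e]) hjw

theorem ModelStructure.homotopic_trans {M : Type u} [Category.{v} M] (S : ModelStructure M)
    {A X : M} (hA : S.Cofibrant A) {f g k : A ⟶ X} :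
    S.Homotopic f g → S.Homotopic g k → S.Homotopic f k := by
  rintro ⟨I, i₀, i₁, p, H, hp, h0, h1, hH0, hH1⟩ ⟨I', i₀', i₁', p', H', hp', h0', h1', hH0', hH1'⟩
  have hi₁ : S.W i₁ := S.twoOfThree₃ i₁ p hp (by rw [h1]; exact (S.id_mem A).1)
  obtain ⟨Z, j, q, hjc, hjw, hq, e⟩ := S.factTrivCofFib i₁
  have hqw : S.W q := S.twoOfThree₂ j q hjw (by rwa [e])
  obtain ⟨O, hO, hOA⟩ := hA
  obtain ⟨l, -, hl⟩ := S.lifting (hO.to A) q hOA hq (Or.inr hqw) (hO.to Z) i₀ (hO.hom_ext _ _)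
  have := S.hasFiniteColimits
  have sq := IsPushout.of_hasPushout j i₀'
  have hk := S.pushout_W sq hjc hjw
  have w1 : j ≫ (q ≫ p) = i₀' ≫ p' := by rw [← Category.assoc, e, h1, h0']
  have w2 : j ≫ (q ≫ H) = i₀' ≫ H' := by rw [← Category.assoc, e, hH1, hH0']
  refine ⟨pushout j i₀', l ≫ pushout.inl _ _, i₁' ≫ pushout.inr _ _, sq.desc _ _ w1,
    sq.desc _ _ w2, ?_, ?_, ?_, ?_, ?_⟩
  · exact S.twoOfThree₂ _ _ hk (by rwa [sq.inr_desc])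
  · rw [Category.assoc, sq.inl_desc, ← Category.assoc, hl, h0]
  · rw [Category.assoc, sq.inr_desc, h1']
  · rw [Category.assoc, sq.inl_desc, ← Category.assoc, hl, hH0]
  · rw [Category.assoc, sq.inr_desc, hH1']

theorem ModelStructure.quot_eq_iff {M : Type u} [Category.{v} M] (S : ModelStructure M)
    {A X : M} (hA : S.Cofibrant A) (f g : A ⟶ X) :
    Quot.mk (fun f g : A ⟶ X => S.Homotopic f g) f = Quot.mk _ g ↔ S.Homotopic f g := by
  constructor
  · intro h
    have h' := Quot.eqvGen_exact h
    clear h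
    induction h' with
    | rel _ _ h => exact h
    | refl _ => exact S.homotopic_refl _
    | symm _ _ h ih => exact S.homotopic_symm ih
    | trans _ _ _ h h' ih ih' =>
      exact S.homotopic_trans hA ih ih'
  · exact fun h => Quot.sound h

theorem UltraCat.exists_isInitial {ι : Type u} (U : Ultrafilter ι) {C : ι → Type v}
    [∀ i, Category.{w} (C i)] (O : UltraCat U C) (h : ∀ i, IsInitial (O i)) :
    Nonempty (IsInitial O) := by
  refine ⟨IsInitial.ofUniqueHom (fun Y => UltraCat.mkHom U (fun i => (h i).to (Y i))) ?_⟩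
  intro Y m
  obtain ⟨m, rfl⟩ := UltraCat.mkHom_surj U m
  exact congrArg _ (funext fun i => (h i).hom_ext _ _)

theorem UltraCat.exists_isTerminal {ι : Type u} (U : Ultrafilter ι) {C : ι → Type v}
    [∀ i, Category.{w} (C i)] (O : UltraCat U C) (h : ∀ i, IsTerminal (O i)) :
    Nonempty (IsTerminal O) := by
  refine ⟨IsTerminal.ofUniqueHom (fun Y => UltraCat.mkHom U (fun i => (h i).from (Y i))) ?_⟩
  intro Y m
  obtain ⟨m, rfl⟩ := UltraCat.mkHom_surj U m
  exact congrArg _ (funext fun i => (h i).hom_ext _ _)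

theorem ultraCat_homotopic_iff {ι : Type u} (U : Ultrafilter ι)
    (M : ι → Type v) [∀ i, Category.{w} (M i)] (S : ∀ i, ModelStructure (M i))
    (T : ModelStructure (UltraCat U M))
    (hW : T.W = germProp U (fun i => (S i).W)) (A X : UltraCat U M) (f g : ∀ i, A i ⟶ X i) :
    T.Homotopic (UltraCat.mkHom U f : A ⟶ X) (UltraCat.mkHom U g) ↔
          {i | (S i).Homotopic (f i) (g i)} ∈ U := by
  constructor
  · rintro ⟨I, i₀, i₁, p, H, h1, h2, h3, h4, h5⟩
    obtain ⟨i₀, rfl⟩ := UltraCat.mkHom_surj U i₀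
    obtain ⟨i₁, rfl⟩ := UltraCat.mkHom_surj U i₁
    obtain ⟨p, rfl⟩ := UltraCat.mkHom_surj U p
    obtain ⟨H, rfl⟩ := UltraCat.mkHom_surj U H
    rw [hW, germProp_mkHom] at h1
    rw [UltraCat.mkHom_comp, UltraCat.id_eq, UltraCat.mkHom_eq_iff] at h2 h3
    rw [UltraCat.mkHom_comp, UltraCat.mkHom_eq_iff] at h4 h5
    filter_upwards [h1, h2, h3, h4, h5] with i h1 h2 h3 h4 h5
    exact ⟨I i, i₀ i, i₁ i, p i, H i, h1, h2, h3, h4, h5⟩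
  · intro h
    have key : ∀ i, ∃ (I : M i) (i₀ i₁ : A i ⟶ I) (p : I ⟶ A i) (H : I ⟶ X i),
        (S i).Homotopic (f i) (g i) → ((S i).W p ∧ i₀ ≫ p = 𝟙 (A i) ∧ i₁ ≫ p = 𝟙 (A i) ∧
          i₀ ≫ H = f i ∧ i₁ ≫ H = g i) := by
      intro i
      by_cases hi : (S i).Homotopic (f i) (g i)
      · obtain ⟨I, i₀, i₁, p, H, hh⟩ := hi
        exact ⟨I, i₀, i₁, p, H, fun _ => hh⟩
      · exact ⟨A i, 𝟙 _, 𝟙 _, 𝟙 _, f i, fun h => absurd h hi⟩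
    obtain ⟨I, key⟩ : ∃ I : UltraCat U M, ∀ i, ∃ (i₀ i₁ : A i ⟶ I i) (p : I i ⟶ A i) (H : I i ⟶ X i),
        (S i).Homotopic (f i) (g i) → ((S i).W p ∧ i₀ ≫ p = 𝟙 (A i) ∧ i₁ ≫ p = 𝟙 (A i) ∧
          i₀ ≫ H = f i ∧ i₁ ≫ H = g i) := by
      choose I hI using key
      exact ⟨I, hI⟩
    choose i₀ i₁ p H hh using key
    refine ⟨I, UltraCat.mkHom U i₀, UltraCat.mkHom U i₁, UltraCat.mkHom U p,
      UltraCat.mkHom U H, ?_, ?_, ?_, ?_, ?_⟩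
    · rw [hW, germProp_mkHom]
      exact Filter.mem_of_superset h fun i hi => (hh i hi).1
    · rw [UltraCat.mkHom_comp, UltraCat.id_eq, UltraCat.mkHom_eq_iff]
      exact Filter.mem_of_superset h fun i hi => (hh i hi).2.1
    · rw [UltraCat.mkHom_comp, UltraCat.id_eq, UltraCat.mkHom_eq_iff]
      exact Filter.mem_of_superset h fun i hi => (hh i hi).2.2.1
    · rw [UltraCat.mkHom_comp, UltraCat.mkHom_eq_iff]
      exact Filter.mem_of_superset h fun i hi => (hh i hi).2.2.2.1
    · rw [UltraCat.mkHom_comp, UltraCat.mkHom_eq_iff]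
      exact Filter.mem_of_superset h fun i hi => (hh i hi).2.2.2.2

/-- for the germwise model structure on `∏_U M i`:
(a) an object is cofibrant (fibrant) iff its components are cofibrant (fibrant)
`U`-almost everywhere; (b) for `A` cofibrant and `X` fibrant, two germs of morphisms
`A ⟶ X` are homotopic iff their components are homotopic `U`-almost everywhere;
in particular `Hom(A, X)/∼` is in canonical bijection with `∏_U π(A i, X i)`. -/
theorem ultraCat_cofibrant_fibrant_homotopic {ι : Type u} (U : Ultrafilter ι)
    (M : ι → Type v) [∀ i, Category.{w} (M i)] (S : ∀ i, ModelStructure (M i))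
    (T : ModelStructure (UltraCat U M))
    (hW : T.W = germProp U (fun i => (S i).W))
    (hFib : T.Fib = germProp U (fun i => (S i).Fib))
    (hCof : T.Cof = germProp U (fun i => (S i).Cof)) :
    (∀ A : UltraCat U M, T.Cofibrant A ↔ {i | (S i).Cofibrant (A i)} ∈ U) ∧
    (∀ X : UltraCat U M, T.Fibrant X ↔ {i | (S i).Fibrant (X i)} ∈ U) ∧
    (∀ A X : UltraCat U M, T.Cofibrant A → T.Fibrant X →
      (∀ f g : ∀ i, A i ⟶ X i,
        T.Homotopic (UltraCat.mkHom U f) (UltraCat.mkHom U g) ↔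
          {i | (S i).Homotopic (f i) (g i)} ∈ U) ∧
      ∃ e : Quot (fun f g : A ⟶ X => T.Homotopic f g) ≃
            Ultraproduct U (fun i => Quot (fun f g : A i ⟶ X i => (S i).Homotopic f g)),
        ∀ f : ∀ i, A i ⟶ X i,
          e (Quot.mk _ (UltraCat.mkHom U f)) =
            Ultraproduct.mk U (fun i => Quot.mk _ (f i))) := by
  have hcof : ∀ A : UltraCat U M, T.Cofibrant A ↔ {i | (S i).Cofibrant (A i)} ∈ U := by
    intro A
    have hc := fun i => (S i).hasFiniteColimits
    let O : UltraCat U M := fun i => ⊥_ (M i)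
    have hO : ∀ i, IsInitial (O i) := fun i => initialIsInitial
    obtain ⟨h⟩ := UltraCat.exists_isInitial U O hO
    rw [T.cofibrant_iff h (UltraCat.mkHom U fun i => (hO i).to (A i)), hCof, germProp_mkHom]
    have : ∀ i, (S i).Cofibrant (A i) ↔ (S i).Cof ((hO i).to (A i)) :=
      fun i => (S i).cofibrant_iff (hO i) _
    simp only [this]
  have hfib : ∀ A : UltraCat U M, T.Fibrant A ↔ {i | (S i).Fibrant (A i)} ∈ U := by
    intro A
    have hc := fun i => (S i).hasFiniteLimits
    let O : UltraCat U M := fun i => ⊤_ (M i)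
    have hO : ∀ i, IsTerminal (O i) := fun i => terminalIsTerminal
    obtain ⟨h⟩ := UltraCat.exists_isTerminal U O hO
    rw [T.fibrant_iff h (UltraCat.mkHom U fun i => (hO i).from (A i)), hFib, germProp_mkHom]
    have : ∀ i, (S i).Fibrant (A i) ↔ (S i).Fib ((hO i).from (A i)) :=
      fun i => (S i).fibrant_iff (hO i) _
    simp only [this]
  refine ⟨hcof, hfib, fun A X hA _ => ⟨ultraCat_homotopic_iff U M S T hW A X, ?_⟩⟩
  have hA' := (hcof A).1 hA
  let φ₀ : (A ⟶ X) →
      Ultraproduct U (fun i => Quot (fun f g : A i ⟶ X i => (S i).Homotopic f g)) :=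
    fun f => Quotient.liftOn f (fun f => Ultraproduct.mk U (fun i => Quot.mk _ (f i)))
      (fun a b h => Quotient.sound (Filter.mem_of_superset h
        (fun i (hi : a i = b i) => congrArg (Quot.mk _) hi)))
  have hφ₀ : ∀ f : ∀ i, A i ⟶ X i, φ₀ (UltraCat.mkHom U f) =
      Ultraproduct.mk U (fun i => Quot.mk _ (f i)) := fun f => rfl
  have hiff : ∀ f g : A ⟶ X, φ₀ f = φ₀ g ↔ T.Homotopic f g := by
    intro f g
    obtain ⟨f, rfl⟩ := UltraCat.mkHom_surj U f
    obtain ⟨g, rfl⟩ := UltraCat.mkHom_surj U g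
    rw [ultraCat_homotopic_iff U M S T hW, hφ₀, hφ₀]
    constructor
    · intro h
      have h := Quotient.exact h
      filter_upwards [h, hA'] with i hi hAi
      exact ((S i).quot_eq_iff hAi _ _).1 hi
    · intro h
      exact Quotient.sound (Filter.mem_of_superset h (fun i hi => Quot.sound hi))
  let φ : Quot (fun f g : A ⟶ X => T.Homotopic f g) →
      Ultraproduct U (fun i => Quot (fun f g : A i ⟶ X i => (S i).Homotopic f g)) :=
    Quot.lift φ₀ (fun a b h => (hiff a b).2 h)
  have hb : Function.Bijective φ := by
    constructor
    · intro a b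
      induction a using Quot.ind with | _ a => ?_
      induction b using Quot.ind with | _ b => ?_
      intro h
      exact Quot.sound ((hiff a b).1 h)
    · intro y
      obtain ⟨s, rfl⟩ := Quotient.exists_rep y
      choose f hf using fun i => Quot.exists_rep (s i)
      refine ⟨Quot.mk _ (UltraCat.mkHom U f), ?_⟩
      exact congrArg (Ultraproduct.mk U) (funext hf)
  exact ⟨Equiv.ofBijective φ hb, fun f => rfl⟩
end

section
/- Let U be an ultrafilter on a set ι and let (X i) be a family of simplicial sets such that {i | X i is a Kan complex} ∈ U. Then the restricted ultraproduct Y (with Y_n = ∏_U (X i)_n and germwise structure maps) is a Kan complex, i.e. for all n ≥ 1 and 0 ≤ k ≤ n, every map of simplicial sets Λᵏ[n] → Y from the k-th horn extends along the inclusion Λᵏ[n] ↪ Δ[n] to a map Δ[n] → Y. -/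
open CategoryTheory Limits Simplicial

universe v u w

/-- The restricted ultraproduct of a family of simplicial sets: its `n`-simplices form
the ultraproduct of the sets of `n`-simplices, with germwise structure maps. -/
def ultraSSet {ι : Type u} (U : Ultrafilter ι) (X : ι → SSet.{v}) : SSet.{max u v} where
  obj m := Ultraproduct U (fun i => (X i).obj m)
  map {m m'} φ :=
    ↾(Quotient.map (fun s i => (X i).map φ (s i))
      (by
        intro s t h
        exact Filter.mem_of_superset h (fun i hi => by
          show (X i).map φ (s i) = (X i).map φ (t i)
          rw [show s i = t i from hi])))
  map_id := by
    intro m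
    ext a
    induction a using Quotient.inductionOn with
    | _ s =>
      exact congrArg (Quotient.mk _) (funext fun i => ConcreteCategory.congr_hom ((X i).map_id m) (s i))
  map_comp := by
    intro m m' m'' φ ψ
    ext a
    induction a using Quotient.inductionOn with
    | _ s =>
      exact congrArg (Quotient.mk _) (funext fun i => ConcreteCategory.congr_hom ((X i).map_comp φ ψ) (s i))

/-- The germwise morphism between restricted ultraproducts induced by a family of
morphisms of simplicial sets. -/
def ultraSSetMap {ι : Type u} (U : Ultrafilter ι) {X Z : ι → SSet.{v}}
    (f : ∀ i, X i ⟶ Z i) : ultraSSet U X ⟶ ultraSSet U Z where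
  app m :=
    ↾(Quotient.map (fun s i => (f i).app m (s i))
      (by
        intro s t h
        exact Filter.mem_of_superset h (fun i hi => by
          show (f i).app m (s i) = (f i).app m (t i)
          rw [show s i = t i from hi])))
  naturality := by
    intro m m' φ
    ext a
    induction a using Quotient.inductionOn with
    | _ s =>
      exact congrArg (Quotient.mk _) (funext fun i => ConcreteCategory.congr_hom ((f i).naturality φ) (s i))

/-- A simplicial set `Y` is a Kan complex if for all `n ≥ 1` and `0 ≤ k ≤ n`, every map
from the horn `Λ[n, k]` to `Y` extends along `Λ[n, k] ↪ Δ[n]` to a map `Δ[n] ⟶ Y`. -/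
def IsKan (Y : SSet.{v}) : Prop :=
  ∀ (n : ℕ), 1 ≤ n → ∀ (k : Fin (n + 1)) (σ : (Λ[n, k] : SSet.{v}) ⟶ Y),
    ∃ τ : Δ[n] ⟶ Y, Λ[n, k].ι ≫ τ = σ

/-- A morphism of simplicial sets is a Kan fibration if it has the right lifting
property with respect to every horn inclusion `Λ[n, k] ↪ Δ[n]` (`n ≥ 1`, `0 ≤ k ≤ n`). -/
def IsKanFibration {X Z : SSet.{v}} (p : X ⟶ Z) : Prop :=
  ∀ (n : ℕ), 1 ≤ n → ∀ (k : Fin (n + 1)) (a : (Λ[n, k] : SSet.{v}) ⟶ X) (b : Δ[n] ⟶ Z),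
    a ≫ p = Λ[n, k].ι ≫ b →
    ∃ c : Δ[n] ⟶ X, Λ[n, k].ι ≫ c = a ∧ c ≫ p = b

/-- Elementwise compatibility of a family of faces. -/
def HornCompat (X : SSet.{v}) (n : ℕ) (i : Fin (n + 2))
    (x : ∀ (j : Fin (n + 2)), j ≠ i → X.obj (Opposite.op ⦋n⦌)) : Prop :=
  match n with
  | 0 => True
  | n + 1 => ∀ (j k : Fin (n + 3)) (hj : j ≠ i) (hk : k ≠ i) (hjk : j < k),
      X.map (SimplexCategory.δ (k.pred (Fin.ne_zero_of_lt hjk))).op (x j hj) =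
      X.map (SimplexCategory.δ (j.castPred (Fin.ne_last_of_lt hjk))).op (x k hk)

lemma hornCompat_iff (X : SSet.{v}) (n : ℕ) (i : Fin (n + 2))
    (x : ∀ (j : Fin (n + 2)), j ≠ i → X.obj (Opposite.op ⦋n⦌)) :
    HornCompat X n i x ↔
      SSet.horn.IsCompatible (i := i) (fun j hj => SSet.yonedaEquiv.symm (x j hj)) := by
  cases n with
  | zero => exact Iff.rfl
  | succ n =>
    refine forall_congr' fun j => forall_congr' fun k => forall_congr' fun hj =>
      forall_congr' fun hk => forall_congr' fun hjk => ?_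
    have e := fun (a : Fin (n+2)) (y : X.obj (Opposite.op ⦋n+1⦌)) =>
      SSet.yonedaEquiv_symm_naturality_left (SimplexCategory.δ a) y
    refine Iff.trans ?_ (Eq.congr (e _ _) (e _ _)).symm
    exact (SSet.yonedaEquiv.symm.injective.eq_iff).symm

lemma isKan_iff (X : SSet.{v}) : IsKan X ↔
    ∀ (n : ℕ) (i : Fin (n + 2)) (x : ∀ (j : Fin (n + 2)), j ≠ i → X.obj (Opposite.op ⦋n⦌)),
      HornCompat X n i x →
      ∃ y : X.obj (Opposite.op ⦋n + 1⦌), ∀ j hj,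
        X.map (SimplexCategory.δ j).op y = x j hj := by
  constructor
  · intro h n i x hx
    rw [hornCompat_iff] at hx
    obtain ⟨τ, hτ⟩ := h (n + 1) (by omega) i hx.desc
    refine ⟨SSet.yonedaEquiv τ, fun j hj => ?_⟩
    have h1 := hx.ι_desc j hj
    rw [← hτ, SSet.horn.ι_ι_assoc] at h1
    rw [SSet.yonedaEquiv_naturality]
    exact (Equiv.eq_symm_apply _).1 h1
  · intro h n hn k σ
    obtain ⟨n, rfl⟩ : ∃ m, n = m + 1 := ⟨n - 1, by omega⟩
    obtain ⟨y, hy⟩ := h n k (fun j hj => SSet.yonedaEquiv (SSet.horn.ι k j hj ≫ σ)) (by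
      rw [hornCompat_iff]
      simpa only [Equiv.symm_apply_apply] using SSet.horn.IsCompatible.of_hom σ)
    refine ⟨SSet.yonedaEquiv.symm y, SSet.horn.hom_ext' fun j hj => ?_⟩
    rw [SSet.horn.ι_ι_assoc]
    refine (SSet.yonedaEquiv_symm_naturality_left (SimplexCategory.δ j) y).trans ?_
    rw [hy j hj, Equiv.symm_apply_apply]

/-- if `U`-almost every member of a family of simplicial sets is a Kan
complex, then the restricted ultraproduct is a Kan complex. -/
theorem ultraSSet_isKan {ι : Type u} (U : Ultrafilter ι) (X : ι → SSet.{v})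
    (h : {i | IsKan (X i)} ∈ U) : IsKan (ultraSSet U X) := by
  rw [isKan_iff]
  intro n k x hx
  have hs : ∀ j hj, ∃ s : ∀ i, (X i).obj (Opposite.op ⦋n⦌), Ultraproduct.mk U s = x j hj :=
    fun j hj => Quotient.exists_rep (x j hj)
  choose s hs using hs
  have hc : ∀ᶠ i in (U : Filter ι), HornCompat (X i) n k (fun j hj => s j hj i) := by
    cases n with
    | zero => exact Filter.Eventually.of_forall fun _ => trivial
    | succ n =>
      refine Filter.eventually_all.2 fun j => Filter.eventually_all.2 fun l =>
        Filter.eventually_all.2 fun hj => Filter.eventually_all.2 fun hl =>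
        Filter.eventually_all.2 fun hjl => ?_
      have := hx j l hj hl hjl
      rw [← hs, ← hs] at this
      exact Quotient.exact this
  have hf : ∀ᶠ i in (U : Filter ι), ∃ y : (X i).obj (Opposite.op ⦋n + 1⦌), ∀ j hj,
      (X i).map (SimplexCategory.δ j).op y = s j hj i := by
    filter_upwards [hc, h] with i hi hK
    exact (isKan_iff _).1 hK n k _ hi
  have hne : ∀ i, Nonempty ((X i).obj (Opposite.op ⦋n + 1⦌)) := by
    intro i
    obtain ⟨j, hj⟩ := exists_ne k
    exact ⟨(X i).map (SimplexCategory.σ 0).op (s j hj i)⟩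
  have hy : ∀ i, ∃ y : (X i).obj (Opposite.op ⦋n + 1⦌),
      (∃ y : (X i).obj (Opposite.op ⦋n + 1⦌), ∀ j hj,
        (X i).map (SimplexCategory.δ j).op y = s j hj i) →
      ∀ j hj, (X i).map (SimplexCategory.δ j).op y = s j hj i := by
    intro i
    by_cases hi : ∃ y : (X i).obj (Opposite.op ⦋n + 1⦌), ∀ j hj,
        (X i).map (SimplexCategory.δ j).op y = s j hj i
    · obtain ⟨y, hy⟩ := hi
      exact ⟨y, fun _ => hy⟩
    · exact ⟨(hne i).some, fun h' => absurd h' hi⟩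
  choose y hy using hy
  refine ⟨Ultraproduct.mk U y, fun j hj => ?_⟩
  rw [← hs j hj]
  refine Quotient.sound ?_
  exact Filter.mem_of_superset hf fun i hi => hy i hi j hj
end

section
/- Let U be an ultrafilter on a set ι and let ((X i, x i)) be a family of pointed Kan complexes. Let Y be the restricted ultraproduct of the X i with basepoint y := the germ of (x i) in Y₀. Fix n ≥ 1. Then the map I_n(Y, y) → ∏_U (I_n(X i, x i)/≈) that sends the germ of a family (α i) (with α i ∈ I_n(X i, x i) for U-almost all i) to the germ of the classes ([α i]) is well defined, and it descends to a bijection from the quotient of I_n(Y, y) by the equivalence relation generated by ≈ onto ∏_U (I_n(X i, x i)/≈), where each I_n(X i, x i) is divided by the equivalence relation generated by ≈. -/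
open CategoryTheory Limits Simplicial

universe v u w

/-- The `m`-fold degenerate basepoint `e_m = σ^{m-1} ⋯ σ^0 x` (with `e_0 = x`). -/
def degPt (X : SSet.{v}) (x : X _⦋0⦌) : ∀ m : ℕ, X _⦋m⦌
  | 0 => x
  | m + 1 => X.σ (Fin.last m) (degPt X x m)

/-- `I_{n+1}(X, x)`: the set of `(n+1)`-simplices all of whose faces are the
degenerate basepoint `e_n`. -/
def simpI (X : SSet.{v}) (x : X _⦋0⦌) (n : ℕ) : Set (X _⦋n + 1⦌) :=
  {y | ∀ i : Fin (n + 2), X.δ i y = degPt X x n}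

/-- The relation `≈` on `I_{n+1}(X, x)`: `y ≈ z` iff there is `w ∈ X_{n+2}` with
`δ^i w = e_{n+1}` for `0 ≤ i ≤ n`, `δ^{n+1} w = y` and `δ^{n+2} w = z`. -/
def simpRel (X : SSet.{v}) (x : X _⦋0⦌) (n : ℕ)
    (y z : simpI X x n) : Prop :=
  ∃ w : X _⦋n + 2⦌,
    (∀ i : Fin (n + 3), (i : ℕ) ≤ n → X.δ i w = degPt X x (n + 1)) ∧
    X.δ (⟨n + 1, by omega⟩ : Fin (n + 3)) w = (y : X _⦋n + 1⦌) ∧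
    X.δ (⟨n + 2, by omega⟩ : Fin (n + 3)) w = (z : X _⦋n + 1⦌)

theorem degPt_map (X : SSet.{v}) (x : X _⦋0⦌) (m : ℕ) :
    ∀ f : SimplexCategory.mk m ⟶ SimplexCategory.mk 0, X.map f.op x = degPt X x m := by
  induction m with
  | zero =>
    intro f
    have : f = 𝟙 _ := Subsingleton.elim _ _
    subst this
    simp [degPt]
  | succ m ih =>
    intro f
    have h : f = SimplexCategory.σ (Fin.last m) ≫
        (SimplexCategory.mk m).const (SimplexCategory.mk 0) 0 := Subsingleton.elim _ _
    subst h
    rw [op_comp, X.map_comp]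
    show X.σ (Fin.last m) (X.map _ x) = X.σ (Fin.last m) (degPt X x m)
    rw [ih]

theorem degPt_δ (X : SSet.{v}) (x : X _⦋0⦌) (m : ℕ) (i : Fin (m + 2)) :
    X.δ i (degPt X x (m + 1)) = degPt X x m := by
  rw [← degPt_map X x (m + 1) ((SimplexCategory.mk (m + 1)).const (SimplexCategory.mk 0) 0),
    ← degPt_map X x m (SimplexCategory.δ i ≫
      (SimplexCategory.mk (m + 1)).const (SimplexCategory.mk 0) 0), op_comp, X.map_comp]
  rfl

theorem simpRel_refl (X : SSet.{v}) (x : X _⦋0⦌) (n : ℕ) (y : simpI X x n) :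
    simpRel X x n y y := by
  refine ⟨X.σ (Fin.last (n + 1)) y.1, ?_, ?_, ?_⟩
  · intro i hi
    have h := SSet.δ_comp_σ_of_le_apply (S := X) (i := (⟨i, by omega⟩ : Fin (n + 2)))
      (j := Fin.last n) (by rw [Fin.le_def]; simpa using hi) y.1
    rw [y.2] at h
    exact h
  · exact SSet.δ_comp_σ_self_apply (S := X) (Fin.last (n + 1)) y.1
  · exact SSet.δ_comp_σ_succ_apply (S := X) (Fin.last (n + 1)) y.1

theorem simpRel_eucl (X : SSet.{v}) (hX : IsKan X) (x : X _⦋0⦌) (n : ℕ) (y z z' : simpI X x n)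
    (h₁ : simpRel X x n y z) (h₂ : simpRel X x n y z') : simpRel X x n z z' := by
  obtain ⟨a, ha, hay, haz⟩ := h₁
  obtain ⟨b, hb, hby, hbz⟩ := h₂
  let F : ℕ → X _⦋n + 2⦌ := fun j =>
    if j ≤ n then degPt X x (n + 2) else if j = n + 1 then a else b
  have F0 : ∀ j ≤ n, F j = degPt X x (n + 2) := fun j hj => if_pos hj
  have F1 : F (n + 1) = a := by simp [F]
  have F2 : F (n + 2) = b := by simp [F]
  let f : ∀ (j : Fin (n + 2 + 2)) (_ : j ≠ Fin.last (n + 3)), Δ[n + 2] ⟶ X :=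
    fun j _ => SSet.yonedaEquiv.symm (F j)
  have hf : SSet.horn.IsCompatible f := by
    rw [SSet.horn.isCompatible_iff]
    intro j k hj hk hjk
    simp only [f, SSet.stdSimplex.δ_comp_yonedaEquiv_symm]
    congr 1
    obtain ⟨j, hj'⟩ := j
    obtain ⟨k, hk'⟩ := k
    simp only [Fin.lt_def] at hjk
    have hk2 : k ≠ n + 3 := fun h => hk (Fin.ext h)
    simp only [Fin.pred_mk, Fin.castPred_mk]
    by_cases hjn : j ≤ n
    · rw [F0 j hjn, degPt_δ]
      by_cases hkn : k ≤ n
      · rw [F0 k hkn, degPt_δ]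
      · obtain rfl | rfl : k = n + 1 ∨ k = n + 2 := by omega
        · rw [F1, ha _ hjn]
        · rw [F2, hb _ hjn]
    · obtain rfl : j = n + 1 := by omega
      obtain rfl : k = n + 2 := by omega
      rw [F1, F2]
      exact hay.trans hby.symm
  obtain ⟨φ, hφ⟩ := hf.exists_desc
  obtain ⟨τ, hτ⟩ := hX (n + 3) (by omega) _ φ
  have key : ∀ (j : Fin (n + 4)), (j : ℕ) ≤ n + 2 → X.δ j (SSet.yonedaEquiv τ) = F j := by
    intro j hj
    have hj' : j ≠ Fin.last (n + 3) := by
      rintro rfl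
      simp at hj
    rw [← SSet.stdSimplex.yonedaEquiv_δ_comp]
    have := hφ j hj'
    rw [← hτ, ← Category.assoc, SSet.horn.ι_ι] at this
    rw [this]
    simp [f]
  have key2 : ∀ i : Fin (n + 3), X.δ i (X.δ (Fin.last (n + 3)) (SSet.yonedaEquiv τ)) =
      X.δ (Fin.last (n + 2)) (F i) := by
    intro i
    have h := SSet.δ_comp_δ_apply (S := X) (Fin.le_last i) (SSet.yonedaEquiv τ)
    have hk : X.δ i.castSucc (SSet.yonedaEquiv τ) = F i :=
      key i.castSucc (Nat.le_of_lt_succ i.2)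
    rw [hk] at h
    exact h
  refine ⟨X.δ (Fin.last (n + 3)) (SSet.yonedaEquiv τ), ?_, ?_, ?_⟩
  · intro i hi
    rw [key2, F0 _ hi, degPt_δ]
  · rw [key2]
    exact (congrArg _ F1).trans haz
  · rw [key2]
    exact (congrArg _ F2).trans hbz

theorem simpRel_of_quot_eq (X : SSet.{v}) (hX : IsKan X) (x : X _⦋0⦌) (n : ℕ) (y z : simpI X x n)
    (h : Quot.mk (simpRel X x n) y = Quot.mk (simpRel X x n) z) : simpRel X x n y z := by
  have hs : ∀ {a b}, simpRel X x n a b → simpRel X x n b a := fun {a b} hab =>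
    simpRel_eucl X hX x n a b a hab (simpRel_refl X x n a)
  have he : Equivalence (simpRel X x n) :=
    ⟨simpRel_refl X x n, hs, fun {a b c} hab hbc => simpRel_eucl X hX x n b a c (hs hab) hbc⟩
  exact Quotient.exact (s := ⟨_, he⟩) h

theorem Ultraproduct.mk_eq {ι : Type u} (U : Ultrafilter ι) {S : ι → Type v} (s t : ∀ i, S i) :
    Ultraproduct.mk U s = Ultraproduct.mk U t ↔ ∀ᶠ i in (U : Filter ι), s i = t i :=
  ⟨fun h => Quotient.exact (s := germSetoid U S) h,
    fun h => Quotient.sound (s := germSetoid U S) h⟩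

theorem ultra_δ_eq {ι : Type u} (U : Ultrafilter ι) (X : ι → SSet.{v}) (m : ℕ) (j : Fin (m + 2))
    (s : ∀ i, (X i) _⦋m + 1⦌) (t : ∀ i, (X i) _⦋m⦌) :
    (ultraSSet U X).δ j (Ultraproduct.mk U s : (ultraSSet U X) _⦋m + 1⦌) = Ultraproduct.mk U t ↔
      ∀ᶠ i in (U : Filter ι), (X i).δ j (s i) = t i :=
  Ultraproduct.mk_eq U (fun i => (X i).δ j (s i)) t

theorem ultra_degPt {ι : Type u} (U : Ultrafilter ι) (X : ι → SSet.{v}) (x : ∀ i, (X i) _⦋0⦌)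
    (m : ℕ) : degPt (ultraSSet U X) (Ultraproduct.mk U x) m =
      Ultraproduct.mk U (fun i => degPt (X i) (x i) m) := by
  induction m with
  | zero => rfl
  | succ m ih =>
    show (ultraSSet U X).σ (Fin.last m) _ = _
    rw [ih]
    rfl

theorem ultra_mem_simpI {ι : Type u} (U : Ultrafilter ι) (X : ι → SSet.{v})
    (x : ∀ i, (X i) _⦋0⦌) (n : ℕ) (s : ∀ i, (X i) _⦋n + 1⦌) :
    (Ultraproduct.mk U s : (ultraSSet U X) _⦋n + 1⦌) ∈
        simpI (ultraSSet U X) (Ultraproduct.mk U x) n ↔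
      ∀ᶠ i in (U : Filter ι), s i ∈ simpI (X i) (x i) n := by
  simp only [simpI, Set.mem_ofPred_eq, ultra_degPt, Filter.eventually_all]
  exact forall_congr' fun j => ultra_δ_eq U X n j s _

theorem ultra_simpRel {ι : Type u} (U : Ultrafilter ι) (X : ι → SSet.{v})
    (x : ∀ i, (X i) _⦋0⦌) (n : ℕ) (α β : ∀ i, simpI (X i) (x i) n)
    (hα : (Ultraproduct.mk U (fun i => (α i).1) : (ultraSSet U X) _⦋n + 1⦌) ∈
        simpI (ultraSSet U X) (Ultraproduct.mk U x) n)
    (hβ : (Ultraproduct.mk U (fun i => (β i).1) : (ultraSSet U X) _⦋n + 1⦌) ∈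
        simpI (ultraSSet U X) (Ultraproduct.mk U x) n) :
    simpRel (ultraSSet U X) (Ultraproduct.mk U x) n ⟨_, hα⟩ ⟨_, hβ⟩ ↔
      ∀ᶠ i in (U : Filter ι), simpRel (X i) (x i) n (α i) (β i) := by
  have main : ∀ w : ∀ i, (X i) _⦋n + 2⦌,
      ((∀ j : Fin (n + 3), (j : ℕ) ≤ n → (ultraSSet U X).δ j
          (Ultraproduct.mk U w : (ultraSSet U X) _⦋n + 2⦌) =
          degPt (ultraSSet U X) (Ultraproduct.mk U x) (n + 1)) ∧
        (ultraSSet U X).δ (⟨n + 1, by omega⟩ : Fin (n + 3))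
          (Ultraproduct.mk U w : (ultraSSet U X) _⦋n + 2⦌) =
          Ultraproduct.mk U (fun i => (α i).1) ∧
        (ultraSSet U X).δ (⟨n + 2, by omega⟩ : Fin (n + 3))
          (Ultraproduct.mk U w : (ultraSSet U X) _⦋n + 2⦌) =
          Ultraproduct.mk U (fun i => (β i).1)) ↔
      ∀ᶠ i in (U : Filter ι),
        (∀ j : Fin (n + 3), (j : ℕ) ≤ n → (X i).δ j (w i) = degPt (X i) (x i) (n + 1)) ∧
        (X i).δ (⟨n + 1, by omega⟩ : Fin (n + 3)) (w i) = (α i).1 ∧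
        (X i).δ (⟨n + 2, by omega⟩ : Fin (n + 3)) (w i) = (β i).1 := by
    intro w
    rw [Filter.eventually_and, Filter.eventually_and, Filter.eventually_all, ultra_degPt]
    refine and_congr (forall_congr' fun j => ?_)
      (and_congr (ultra_δ_eq U X _ _ w _) (ultra_δ_eq U X _ _ w _))
    rw [Filter.eventually_imp_distrib_left]
    exact imp_congr_right fun _ => ultra_δ_eq U X _ j w _
  constructor
  · rintro ⟨w, hw⟩
    obtain ⟨w, rfl⟩ : ∃ w', Ultraproduct.mk U w' = w := Quotient.exists_rep w
    exact ((main w).1 hw).mono fun i hi => ⟨w i, hi⟩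
  · intro h
    classical
    let w : ∀ i, (X i) _⦋n + 2⦌ := fun i =>
      if hi : simpRel (X i) (x i) n (α i) (β i) then hi.choose else degPt (X i) (x i) (n + 2)
    refine ⟨Ultraproduct.mk U w, (main w).2 (h.mono fun i hi => ?_)⟩
    have : w i = hi.choose := dif_pos hi
    rw [this]
    exact hi.choose_spec

theorem ultra_simpI_rep {ι : Type u} (U : Ultrafilter ι) (X : ι → SSet.{v})
    (x : ∀ i, (X i) _⦋0⦌) (n : ℕ) (y : (ultraSSet U X) _⦋n + 1⦌)
    (hy : y ∈ simpI (ultraSSet U X) (Ultraproduct.mk U x) n) :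
    ∃ α : ∀ i, simpI (X i) (x i) n, Ultraproduct.mk U (fun i => (α i).1) = y := by
  classical
  obtain ⟨s, rfl⟩ : ∃ s, Ultraproduct.mk U s = y := Quotient.exists_rep y
  have h := (ultra_mem_simpI U X x n s).1 hy
  refine ⟨fun i => if hi : s i ∈ simpI (X i) (x i) n then ⟨s i, hi⟩ else
    ⟨degPt (X i) (x i) (n + 1), fun j => degPt_δ _ _ _ _⟩, ?_⟩
  refine (Ultraproduct.mk_eq U _ _).2 (h.mono fun i hi => ?_)
  exact congrArg Subtype.val (dif_pos hi)

/-- for a family of pointed Kan complexes `(X i, x i)` and the restricted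
ultraproduct `Y` with basepoint `y = [x i]` and `n ≥ 1` (here `n + 1`), the map sending
the germ of a family `(α i)` with `α i ∈ I_n(X i, x i)` to the germ of its classes is
well defined and descends to a bijection from the quotient of `I_n(Y, y)` by the
equivalence relation generated by `≈` onto `∏_U (I_n(X i, x i)/≈)`. -/
theorem ultraSSet_homotopy_sets {ι : Type u} (U : Ultrafilter ι)
    (X : ι → SSet.{v}) (x : ∀ i, (X i) _⦋0⦌) (hKan : ∀ i, IsKan (X i)) (n : ℕ) :
    ∃ hmem : ∀ α : ∀ i, simpI (X i) (x i) n,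
        (Ultraproduct.mk U (fun i => ((α i : (X i) _⦋n + 1⦌))) :
          (ultraSSet U X) _⦋n + 1⦌) ∈ simpI (ultraSSet U X) (Ultraproduct.mk U x) n,
      ∃ e : Quot (simpRel (ultraSSet U X) (Ultraproduct.mk U x) n) ≃
            Ultraproduct U (fun i => Quot (simpRel (X i) (x i) n)),
        ∀ α : ∀ i, simpI (X i) (x i) n,
          e (Quot.mk _ ⟨_, hmem α⟩) = Ultraproduct.mk U (fun i => Quot.mk _ (α i)) := by
  have hmem : ∀ α : ∀ i, simpI (X i) (x i) n,
      (Ultraproduct.mk U (fun i => ((α i : (X i) _⦋n + 1⦌))) :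
        (ultraSSet U X) _⦋n + 1⦌) ∈ simpI (ultraSSet U X) (Ultraproduct.mk U x) n := fun α =>
    (ultra_mem_simpI U X x n _).2 (Filter.Eventually.of_forall fun i => (α i).2)
  refine ⟨hmem, ?_⟩
  choose r hr using ultra_simpI_rep U X x n
  let Y := simpI (ultraSSet U X) (Ultraproduct.mk U x) n
  have hrel : ∀ α β : ∀ i, simpI (X i) (x i) n,
      simpRel (ultraSSet U X) (Ultraproduct.mk U x) n ⟨_, hmem α⟩ ⟨_, hmem β⟩ ↔
      Ultraproduct.mk U (fun i => Quot.mk (simpRel (X i) (x i) n) (α i)) =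
        Ultraproduct.mk U (fun i => Quot.mk (simpRel (X i) (x i) n) (β i)) := by
    intro α β
    rw [ultra_simpRel U X x n α β, Ultraproduct.mk_eq]
    refine Filter.eventually_congr (Filter.Eventually.of_forall fun i => ?_)
    exact ⟨fun h => Quot.sound h, simpRel_of_quot_eq _ (hKan i) _ _ _ _⟩
  have hrr : ∀ y : Y, (⟨_, hmem (r y.1 y.2)⟩ : Y) = y := fun y => Subtype.ext (hr y.1 y.2)
  let Φ : Quot (simpRel (ultraSSet U X) (Ultraproduct.mk U x) n) →
      Ultraproduct U (fun i => Quot (simpRel (X i) (x i) n)) :=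
    Quot.lift (fun y => Ultraproduct.mk U (fun i => Quot.mk _ (r y.1 y.2 i))) (by
      intro y z h
      refine (hrel _ _).1 ?_
      rw [hrr y, hrr z]
      exact h)
  have hΦ : ∀ α : ∀ i, simpI (X i) (x i) n,
      Φ (Quot.mk _ ⟨_, hmem α⟩) = Ultraproduct.mk U (fun i => Quot.mk _ (α i)) := by
    intro α
    refine (hrel _ _).1 ?_
    rw [hrr ⟨_, hmem α⟩]
    exact simpRel_refl _ _ _ _
  refine ⟨Equiv.ofBijective Φ ⟨?_, ?_⟩, hΦ⟩
  · rintro ⟨y⟩ ⟨z⟩ h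
    have h' := (hrel _ _).2 h
    rw [hrr y, hrr z] at h'
    exact Quot.sound h'
  · intro q
    obtain ⟨s, rfl⟩ : ∃ s, Ultraproduct.mk U s = q := Quotient.exists_rep q
    choose α hα using fun i => Quot.exists_rep (s i)
    exact ⟨Quot.mk _ ⟨_, hmem α⟩, (hΦ α).trans (congrArg _ (funext hα))⟩
end

section
/- Let U be an ultrafilter on a set ι and let (A i) be a family of abelian categories. Then the ultraproduct category ∏_U A i, with addition on hom-sets defined germwise ([f i] + [g i] := [f i + g i]), is an abelian category: it is preadditive, has a zero object (the family of zero objects), has finite biproducts, every morphism has a kernel and a cokernel, every monomorphism is the kernel of some morphism, and every epimorphism is the cokernel of some morphism. -/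
open CategoryTheory Limits ZeroObject

universe w v u

/-- Germwise addition on an ultraproduct of abelian groups. -/
instance Ultraproduct.instAdd {ι : Type u} (U : Ultrafilter ι)
    (S : ι → Type v) [∀ i, AddCommGroup (S i)] : Add (Ultraproduct U S) where
  add a b :=
    Quotient.liftOn₂ a b (fun f g => Ultraproduct.mk U (fun i => f i + g i))
      (by
        intro a₁ a₂ b₁ b₂ h₁ h₂
        exact Quotient.sound (Filter.mem_of_superset (Filter.inter_mem h₁ h₂)
          (fun i hi => by
            show a₁ i + a₂ i = b₁ i + b₂ i
            rw [show a₁ i = b₁ i from hi.1, show a₂ i = b₂ i from hi.2])))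

/-- The germ of the zero family. -/
instance Ultraproduct.instZero {ι : Type u} (U : Ultrafilter ι)
    (S : ι → Type v) [∀ i, AddCommGroup (S i)] : Zero (Ultraproduct U S) where
  zero := Ultraproduct.mk U (fun _ => 0)

/-- Germwise negation on an ultraproduct of abelian groups. -/
instance Ultraproduct.instNeg {ι : Type u} (U : Ultrafilter ι)
    (S : ι → Type v) [∀ i, AddCommGroup (S i)] : Neg (Ultraproduct U S) where
  neg a :=
    Quotient.liftOn a (fun f => Ultraproduct.mk U (fun i => -f i))
      (by
        intro a b h
        exact Quotient.sound (Filter.mem_of_superset h (fun i hi => by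
          show -a i = -b i
          rw [show a i = b i from hi])))

/-- The germwise abelian group structure on an ultraproduct of abelian groups. -/
instance Ultraproduct.instAddCommGroup {ι : Type u} (U : Ultrafilter ι)
    (S : ι → Type v) [∀ i, AddCommGroup (S i)] : AddCommGroup (Ultraproduct U S) where
  add := (· + ·)
  zero := 0
  neg := (- ·)
  add_assoc a b c := by
    induction a using Quotient.inductionOn with
    | _ f =>
      induction b using Quotient.inductionOn with
      | _ g =>
        induction c using Quotient.inductionOn with
        | _ h => exact congrArg (Quotient.mk _) (funext fun i => add_assoc (f i) (g i) (h i))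
  zero_add a := by
    induction a using Quotient.inductionOn with
    | _ f => exact congrArg (Quotient.mk _) (funext fun i => zero_add (f i))
  add_zero a := by
    induction a using Quotient.inductionOn with
    | _ f => exact congrArg (Quotient.mk _) (funext fun i => add_zero (f i))
  neg_add_cancel a := by
    induction a using Quotient.inductionOn with
    | _ f => exact congrArg (Quotient.mk _) (funext fun i => neg_add_cancel (f i))
  add_comm a b := by
    induction a using Quotient.inductionOn with
    | _ f =>
      induction b using Quotient.inductionOn with
      | _ g => exact congrArg (Quotient.mk _) (funext fun i => add_comm (f i) (g i))
  nsmul := nsmulRec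
  zsmul := zsmulRec

/-- The germwise preadditive structure on an ultraproduct of preadditive categories. -/
instance UltraCat.instPreadditive {ι : Type u} (U : Ultrafilter ι) (C : ι → Type v)
    [∀ i, Category.{w} (C i)] [∀ i, Preadditive (C i)] :
    Preadditive (UltraCat U C) where
  homGroup P Q := @Ultraproduct.instAddCommGroup ι U (fun i => P i ⟶ Q i)
    (fun i => Preadditive.homGroup (P i) (Q i))
  add_comp P Q R f f' g := by
    induction f using Quotient.inductionOn with
    | _ a =>
      induction f' using Quotient.inductionOn with
      | _ a' =>
        induction g using Quotient.inductionOn with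
        | _ b =>
          exact congrArg (Quotient.mk _)
            (funext fun i => Preadditive.add_comp _ _ _ (a i) (a' i) (b i))
  comp_add P Q R f g g' := by
    induction f using Quotient.inductionOn with
    | _ a =>
      induction g using Quotient.inductionOn with
      | _ b =>
        induction g' using Quotient.inductionOn with
        | _ b' =>
          exact congrArg (Quotient.mk _)
            (funext fun i => Preadditive.comp_add _ _ _ (a i) (b i) (b' i))

namespace UltraCat

theorem mkHom_surj_s11 {ι : Type u} {U : Ultrafilter ι} {C : ι → Type v}
    [∀ i, Category.{w} (C i)] {X Y : UltraCat U C} (f : X ⟶ Y) :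
    ∃ a : ∀ i, X i ⟶ Y i, mkHom U a = f :=
  Quotient.exists_rep f

theorem mkHom_eq_iff_s11 {ι : Type u} {U : Ultrafilter ι} {C : ι → Type v}
    [∀ i, Category.{w} (C i)] {X Y : UltraCat U C} {a b : ∀ i, X i ⟶ Y i} :
    (mkHom U a : X ⟶ Y) = mkHom U b ↔ ∀ᶠ i in (U : Filter ι), a i = b i :=
  ⟨fun h => Quotient.exact h, fun h => Quotient.sound h⟩

theorem mkHom_comp_s11 {ι : Type u} {U : Ultrafilter ι} {C : ι → Type v}
    [∀ i, Category.{w} (C i)] {X Y Z : UltraCat U C} (a : ∀ i, X i ⟶ Y i)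
    (b : ∀ i, Y i ⟶ Z i) :
    (mkHom U a : X ⟶ Y) ≫ (mkHom U b : Y ⟶ Z) = mkHom U (fun i => a i ≫ b i) := rfl

theorem mkHom_id {ι : Type u} {U : Ultrafilter ι} {C : ι → Type v}
    [∀ i, Category.{w} (C i)] (X : UltraCat U C) :
    𝟙 X = mkHom U (fun i => 𝟙 (X i)) := rfl

section
variable {ι : Type u} {U : Ultrafilter ι} {C : ι → Type v}
    [∀ i, Category.{w} (C i)] [∀ i, Preadditive (C i)]

theorem mkHom_add {X Y : UltraCat U C} (a b : ∀ i, X i ⟶ Y i) :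
    (mkHom U a : X ⟶ Y) + mkHom U b = mkHom U (fun i => a i + b i) := rfl

theorem mkHom_zero (X Y : UltraCat U C) :
    (0 : X ⟶ Y) = mkHom U (fun i => (0 : X i ⟶ Y i)) := rfl

theorem isKernel {K X Y : UltraCat U C} (k : ∀ i, K i ⟶ X i) (a : ∀ i, X i ⟶ Y i)
    (w : (mkHom U k : K ⟶ X) ≫ (mkHom U a : X ⟶ Y) = 0)
    (h : ∀ᶠ i in (U : Filter ι), Mono (k i) ∧
      ∀ (W : C i) (g : W ⟶ X i), g ≫ a i = 0 → ∃ l : W ⟶ K i, l ≫ k i = g) :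
    Nonempty (IsLimit (KernelFork.ofι (mkHom U k : K ⟶ X) w)) := by
  have ex : ∀ {W : UltraCat U C} (g : W ⟶ X), g ≫ (mkHom U a : X ⟶ Y) = 0 →
      ∃ l : W ⟶ K, l ≫ (mkHom U k : K ⟶ X) = g := by
    intro W g hg
    obtain ⟨g, rfl⟩ := mkHom_surj_s11 g
    rw [mkHom_comp_s11, mkHom_zero, mkHom_eq_iff_s11] at hg
    classical
    refine ⟨mkHom U (fun i => if H : ∃ l : W i ⟶ K i, l ≫ k i = g i then H.choose else 0), ?_⟩
    rw [mkHom_comp_s11, mkHom_eq_iff_s11]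
    filter_upwards [hg, h] with i h1 h2
    have H := h2.2 _ _ h1
    rw [dif_pos H]
    exact H.choose_spec
  have un : ∀ {W : UltraCat U C} (l m : W ⟶ K), l ≫ (mkHom U k : K ⟶ X) = m ≫ mkHom U k →
      l = m := by
    intro W l m hlm
    obtain ⟨l, rfl⟩ := mkHom_surj_s11 l
    obtain ⟨m, rfl⟩ := mkHom_surj_s11 m
    rw [mkHom_comp_s11, mkHom_comp_s11, mkHom_eq_iff_s11] at hlm
    rw [mkHom_eq_iff_s11]
    filter_upwards [hlm, h] with i h1 h2
    have := h2.1
    exact (cancel_mono (k i)).1 h1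
  exact ⟨KernelFork.IsLimit.ofι _ w (fun g hg => (ex g hg).choose)
    (fun g hg => (ex g hg).choose_spec)
    (fun g hg m hm => un _ _ (hm.trans (ex g hg).choose_spec.symm))⟩

theorem isCokernel {X Y K : UltraCat U C} (a : ∀ i, X i ⟶ Y i) (k : ∀ i, Y i ⟶ K i)
    (w : (mkHom U a : X ⟶ Y) ≫ (mkHom U k : Y ⟶ K) = 0)
    (h : ∀ᶠ i in (U : Filter ι), Epi (k i) ∧
      ∀ (W : C i) (g : Y i ⟶ W), a i ≫ g = 0 → ∃ l : K i ⟶ W, k i ≫ l = g) :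
    Nonempty (IsColimit (CokernelCofork.ofπ (mkHom U k : Y ⟶ K) w)) := by
  have ex : ∀ {W : UltraCat U C} (g : Y ⟶ W), (mkHom U a : X ⟶ Y) ≫ g = 0 →
      ∃ l : K ⟶ W, (mkHom U k : Y ⟶ K) ≫ l = g := by
    intro W g hg
    obtain ⟨g, rfl⟩ := mkHom_surj_s11 g
    rw [mkHom_comp_s11, mkHom_zero, mkHom_eq_iff_s11] at hg
    classical
    refine ⟨mkHom U (fun i => if H : ∃ l : K i ⟶ W i, k i ≫ l = g i then H.choose else 0), ?_⟩
    rw [mkHom_comp_s11, mkHom_eq_iff_s11]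
    filter_upwards [hg, h] with i h1 h2
    have H := h2.2 _ _ h1
    rw [dif_pos H]
    exact H.choose_spec
  have un : ∀ {W : UltraCat U C} (l m : K ⟶ W), (mkHom U k : Y ⟶ K) ≫ l = mkHom U k ≫ m →
      l = m := by
    intro W l m hlm
    obtain ⟨l, rfl⟩ := mkHom_surj_s11 l
    obtain ⟨m, rfl⟩ := mkHom_surj_s11 m
    rw [mkHom_comp_s11, mkHom_comp_s11, mkHom_eq_iff_s11] at hlm
    rw [mkHom_eq_iff_s11]
    filter_upwards [hlm, h] with i h1 h2
    have := h2.1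
    exact (cancel_epi (k i)).1 h1
  exact ⟨CokernelCofork.IsColimit.ofπ _ w (fun g hg => (ex g hg).choose)
    (fun g hg => (ex g hg).choose_spec)
    (fun g hg m hm => un _ _ (hm.trans (ex g hg).choose_spec.symm))⟩

end

end UltraCat

/-- the ultraproduct of a family of abelian categories, with germwise
addition on hom-sets, is an abelian category: it is preadditive (witnessed by the
germwise addition), the family of zero objects is a zero object, it has finite
biproducts, kernels and cokernels, every monomorphism is a kernel (a normal
monomorphism) and every epimorphism is a cokernel (a normal epimorphism). -/
theorem ultraCat_abelian {ι : Type u} (U : Ultrafilter ι)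
    (A : ι → Type v) [∀ i, Category.{w} (A i)] [∀ i, Abelian (A i)] :
    (∀ (X Y : UltraCat U A) (f g : ∀ i, X i ⟶ Y i),
      UltraCat.mkHom U f + UltraCat.mkHom U g = UltraCat.mkHom U (fun i => f i + g i)) ∧
    IsZero (show UltraCat U A from fun i => (0 : A i)) ∧
    HasBinaryBiproducts (UltraCat U A) ∧
    HasKernels (UltraCat U A) ∧
    HasCokernels (UltraCat U A) ∧
    (∀ (X Y : UltraCat U A) (f : X ⟶ Y), Mono f → Nonempty (NormalMono f)) ∧
    (∀ (X Y : UltraCat U A) (f : X ⟶ Y), Epi f → Nonempty (NormalEpi f)) := by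
  refine ⟨fun _ _ _ _ => rfl, ?_, ?_, ?_, ?_, ?_, ?_⟩
  · rw [IsZero.iff_id_eq_zero, UltraCat.mkHom_id, UltraCat.mkHom_zero, UltraCat.mkHom_eq_iff_s11]
    exact Filter.Eventually.of_forall fun i => (isZero_zero (A i)).eq_of_src _ _
  · refine ⟨fun X Y => ?_⟩
    let P : UltraCat U A := fun i => X i ⊞ Y i
    let b : BinaryBicone X Y :=
      { pt := P
        fst := (UltraCat.mkHom U (fun i => (biprod.fst : X i ⊞ Y i ⟶ X i)) : P ⟶ X)
        snd := (UltraCat.mkHom U (fun i => (biprod.snd : X i ⊞ Y i ⟶ Y i)) : P ⟶ Y)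
        inl := (UltraCat.mkHom U (fun i => (biprod.inl : X i ⟶ X i ⊞ Y i)) : X ⟶ P)
        inr := (UltraCat.mkHom U (fun i => (biprod.inr : Y i ⟶ X i ⊞ Y i)) : Y ⟶ P)
        inl_fst := UltraCat.mkHom_eq_iff_s11.2 (Filter.Eventually.of_forall fun i => biprod.inl_fst)
        inl_snd := UltraCat.mkHom_eq_iff_s11.2 (Filter.Eventually.of_forall fun i => biprod.inl_snd)
        inr_fst := UltraCat.mkHom_eq_iff_s11.2 (Filter.Eventually.of_forall fun i => biprod.inr_fst)
        inr_snd := UltraCat.mkHom_eq_iff_s11.2 (Filter.Eventually.of_forall fun i => biprod.inr_snd) }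
    exact HasBinaryBiproduct.mk ⟨b, isBinaryBilimitOfTotal b
      (UltraCat.mkHom_eq_iff_s11.2 (Filter.Eventually.of_forall fun i => biprod.total))⟩
  · refine ⟨fun {X Y} f => ?_⟩
    obtain ⟨a, rfl⟩ := UltraCat.mkHom_surj_s11 f
    let K : UltraCat U A := fun i => kernel (a i)
    obtain ⟨h⟩ := UltraCat.isKernel (K := K) (fun i => kernel.ι (a i)) a
      (UltraCat.mkHom_eq_iff_s11.2 (Filter.Eventually.of_forall fun i => kernel.condition (a i)))
      (Filter.Eventually.of_forall fun i => ⟨inferInstance,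
        fun W g hg => ⟨kernel.lift _ g hg, kernel.lift_ι _ _ _⟩⟩)
    exact ⟨⟨_, h⟩⟩
  · refine ⟨fun {X Y} f => ?_⟩
    obtain ⟨a, rfl⟩ := UltraCat.mkHom_surj_s11 f
    let K : UltraCat U A := fun i => cokernel (a i)
    obtain ⟨h⟩ := UltraCat.isCokernel (K := K) a (fun i => cokernel.π (a i))
      (UltraCat.mkHom_eq_iff_s11.2 (Filter.Eventually.of_forall fun i => cokernel.condition (a i)))
      (Filter.Eventually.of_forall fun i => ⟨inferInstance,
        fun W g hg => ⟨cokernel.desc _ g hg, cokernel.π_desc _ _ _⟩⟩)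
    exact ⟨⟨_, h⟩⟩
  · intro X Y f hf
    obtain ⟨a, rfl⟩ := UltraCat.mkHom_surj_s11 f
    let K : UltraCat U A := fun i => kernel (a i)
    have h0 : (UltraCat.mkHom U (fun i => kernel.ι (a i)) : K ⟶ X) = 0 := by
      rw [← cancel_mono (UltraCat.mkHom U a : X ⟶ Y), zero_comp]
      exact UltraCat.mkHom_eq_iff_s11.2 (Filter.Eventually.of_forall fun i => kernel.condition (a i))
    have hm : ∀ᶠ i in (U : Filter ι), Mono (a i) := by
      filter_upwards [UltraCat.mkHom_eq_iff_s11.1 h0] with i hi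
      exact Preadditive.mono_of_kernel_zero hi
    let Q : UltraCat U A := fun i => cokernel (a i)
    have w : (UltraCat.mkHom U a : X ⟶ Y) ≫
        (UltraCat.mkHom U (fun i => cokernel.π (a i)) : Y ⟶ Q) = 0 :=
      UltraCat.mkHom_eq_iff_s11.2 (Filter.Eventually.of_forall fun i => cokernel.condition (a i))
    obtain ⟨h⟩ := UltraCat.isKernel a (fun i => cokernel.π (a i)) w (by
      filter_upwards [hm] with i hi
      exact ⟨hi, fun W g hg => ⟨Abelian.monoLift (a i) g hg, Abelian.monoLift_comp _ _ _⟩⟩)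
    exact ⟨⟨Q, _, w, h⟩⟩
  · intro X Y f hf
    obtain ⟨a, rfl⟩ := UltraCat.mkHom_surj_s11 f
    let K : UltraCat U A := fun i => cokernel (a i)
    have h0 : (UltraCat.mkHom U (fun i => cokernel.π (a i)) : Y ⟶ K) = 0 := by
      rw [← cancel_epi (UltraCat.mkHom U a : X ⟶ Y), comp_zero]
      exact UltraCat.mkHom_eq_iff_s11.2 (Filter.Eventually.of_forall fun i => cokernel.condition (a i))
    have hm : ∀ᶠ i in (U : Filter ι), Epi (a i) := by
      filter_upwards [UltraCat.mkHom_eq_iff_s11.1 h0] with i hi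
      exact Preadditive.epi_of_cokernel_zero hi
    let Q : UltraCat U A := fun i => kernel (a i)
    have w : (UltraCat.mkHom U (fun i => kernel.ι (a i)) : Q ⟶ X) ≫
        (UltraCat.mkHom U a : X ⟶ Y) = 0 :=
      UltraCat.mkHom_eq_iff_s11.2 (Filter.Eventually.of_forall fun i => kernel.condition (a i))
    obtain ⟨h⟩ := UltraCat.isCokernel (fun i => kernel.ι (a i)) a w (by
      filter_upwards [hm] with i hi
      exact ⟨hi, fun W g hg => ⟨Abelian.epiDesc (a i) g hg, Abelian.comp_epiDesc _ _ _⟩⟩)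
    exact ⟨⟨Q, _, w, h⟩⟩
end
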